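/- arXiv:2603.29567 — 2 statements merged into one kernel-verified Lean document; each statement's English description precedes it below -/
import Mathlib

section
/- Fix ε > 0 and α ∈ [0,1]. If IP(μ) ≠ ∅, then there exists an admissible irrigation plan χ ∈ IP(μ) that minimizes the mollified irrigation cost E^α_ε over IP(μ), i.e. E^α_ε(χ) ≤ E^α_ε(χ') for every χ' ∈ IP(μ). -/
open MeasureTheory Filter Topology
open scoped ENNReal NNReal

noncomputable section

/-- Euclidean space `ℝ^d`. -/
abbrev Euc (d : ℕ) : Type := EuclideanSpace ℝ (Fin d)

/-- `Θ = [0, M]` where `M = μ(ℝ^d)` is the total mass. -/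
def Theta {d : ℕ} (μ : Measure (Euc d)) : Set ℝ := Set.Icc 0 (μ Set.univ).toReal

/-- The stopping time `T(θ)` of a Lagrangian path. -/
def stopTime {d : ℕ} (χ : ℝ → ℝ → Euc d) (θ : ℝ) : ℝ :=
  sInf {t : ℝ | 0 < t ∧ ∀ t' ≥ t, χ θ t' = χ θ t}

/-- An admissible irrigation plan for the measure `μ`: measurable, `1`-Lipschitz and eventually
constant paths, all starting at the origin, whose final positions push the Lebesgue measure
on `Θ = [0,M]` forward onto `μ`. -/
structure IsIrrigPlan {d : ℕ} (μ : Measure (Euc d)) (χ : ℝ → ℝ → Euc d) : Prop where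
  measurable : Measurable (Function.uncurry χ)
  lipschitz : ∀ θ ∈ Theta μ, LipschitzWith 1 (χ θ)
  eventuallyConst : ∀ θ ∈ Theta μ, ∃ t, 0 < t ∧ ∀ t' ≥ t, χ θ t' = χ θ t
  init : ∀ θ ∈ Theta μ, χ θ 0 = 0
  pushforward :
    Measure.map (fun θ => χ θ (stopTime χ θ)) (volume.restrict (Theta μ)) = μ

/-- The multiplicity `|x|_χ`: the measure of the set of particles passing through `x`. -/
def mult {d : ℕ} (μ : Measure (Euc d)) (χ : ℝ → ℝ → Euc d) (x : Euc d) : ℝ≥0∞ :=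
  volume {θ ∈ Theta μ | ∃ t, 0 ≤ t ∧ χ θ t = x}

/-- The `α`-irrigation cost `E^α(χ)`. -/
def irrCost {d : ℕ} (μ : Measure (Euc d)) (α : ℝ) (χ : ℝ → ℝ → Euc d) : ℝ≥0∞ :=
  ∫⁻ θ in Theta μ, ∫⁻ t in Set.Ici (0:ℝ),
    (mult μ χ (χ θ t)) ^ (α - 1) * (‖deriv (χ θ) t‖₊ : ℝ≥0∞)

/-- `ρ(θ,x) = min_{t ≥ 0} |χ(θ,t) − x|`. -/
def pathInfDist {d : ℕ} (χ : ℝ → ℝ → Euc d) (θ : ℝ) (x : Euc d) : ℝ :=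
  ⨅ t : Set.Ici (0:ℝ), dist (χ θ (t : ℝ)) x

/-- A mollifying kernel: a nonnegative, non-increasing, Lipschitz function on `ℝ₊`
with `J(0) = 1` and `J(r) → 0` as `r → ∞`. -/
def MollKernel (J : ℝ → ℝ) : Prop :=
  (∀ r, 0 ≤ r → 0 ≤ J r) ∧ AntitoneOn J (Set.Ici 0) ∧
    (∃ K : ℝ≥0, LipschitzOnWith K J (Set.Ici 0)) ∧ J 0 = 1 ∧ Tendsto J atTop (𝓝 0)

/-- The mollified multiplicity `W_ε(x,χ) = ∫_Θ J_ε(min_{t≥0} |χ(θ,t) − x|) dθ`. -/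
def Wmol {d : ℕ} (μ : Measure (Euc d)) (J : ℝ → ℝ) (ε : ℝ) (χ : ℝ → ℝ → Euc d)
    (x : Euc d) : ℝ≥0∞ :=
  ∫⁻ θ in Theta μ, ENNReal.ofReal (J (pathInfDist χ θ x / ε))

/-- The mollified irrigation cost `E^α_ε(χ)`. -/
def Emol {d : ℕ} (μ : Measure (Euc d)) (J : ℝ → ℝ) (α ε : ℝ)
    (χ : ℝ → ℝ → Euc d) : ℝ≥0∞ :=
  ∫⁻ θ in Theta μ, ∫⁻ t in Set.Ici (0:ℝ),
    (Wmol μ J ε χ (χ θ t)) ^ (α - 1) * (‖deriv (χ θ) t‖₊ : ℝ≥0∞)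

/-- The distance `d(γ₀,γ₁) = sup_{k ≥ 1} (1/k) ‖γ₀ − γ₁‖_{L^∞([0,k])}` between paths. -/
def dPath {d : ℕ} (γ₀ γ₁ : ℝ → Euc d) : ℝ :=
  ⨆ k : ℕ+, (1 / ((k : ℕ) : ℝ)) *
    ⨆ t : Set.Icc (0:ℝ) ((k : ℕ) : ℝ), dist (γ₀ (t : ℝ)) (γ₁ (t : ℝ))

/-- Convergence `χ_n → χ` of irrigation plans: `d(χ_n(θ,·), χ(θ,·)) → 0` for a.e. `θ ∈ Θ`. -/
def PlansTendsto {d : ℕ} (μ : Measure (Euc d)) (χs : ℕ → ℝ → ℝ → Euc d)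
    (χ : ℝ → ℝ → Euc d) : Prop :=
  ∀ᵐ θ ∂(volume.restrict (Theta μ)),
    Tendsto (fun n => dPath (χs n θ) (χ θ)) atTop (𝓝 0)

/-- The plan `χ` is parameterized by arc-length: for a.e. `t`, `|∂_t χ(θ,t)| = 1` for
`0 < t < T(θ)` and `|∂_t χ(θ,t)| = 0` for `t > T(θ)`. -/
def ArcLength {d : ℕ} (μ : Measure (Euc d)) (χ : ℝ → ℝ → Euc d) : Prop :=
  ∀ θ ∈ Theta μ, ∀ᵐ t ∂(volume : Measure ℝ),
    (0 < t → t < stopTime χ θ → ‖deriv (χ θ) t‖ = 1) ∧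
    (stopTime χ θ < t → ‖deriv (χ θ) t‖ = 0)

/-- An alternative mollifying kernel: smooth, positive, strictly decreasing on `ℝ₊`,
with `1 ≤ ∫₀^∞ J(r) dr < ∞`. -/
def MollKernel2 (J : ℝ → ℝ) : Prop :=
  ContDiffOn ℝ (⊤ : ℕ∞) J (Set.Ici 0) ∧ (∀ r, 0 ≤ r → 0 < J r) ∧ StrictAntiOn J (Set.Ici 0) ∧
    IntegrableOn J (Set.Ioi 0) volume ∧ 1 ≤ ∫ r in Set.Ioi (0:ℝ), J r

/-- The alternative mollified multiplicity
`W̃_ε(x,χ) = ∫_Θ min{1, ∫₀^∞ (1/ε) J_ε(|χ(θ,t) − x|) |∂_t χ(θ,t)| dt} dθ`. -/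
def Wtil {d : ℕ} (μ : Measure (Euc d)) (J : ℝ → ℝ) (ε : ℝ) (χ : ℝ → ℝ → Euc d)
    (x : Euc d) : ℝ≥0∞ :=
  ∫⁻ θ in Theta μ,
    min 1 (∫⁻ t in Set.Ici (0:ℝ),
      ENNReal.ofReal ((1 / ε) * J (dist (χ θ t) x / ε)) * (‖deriv (χ θ) t‖₊ : ℝ≥0∞))

/-- The alternative mollified irrigation cost `Ẽ^α_ε(χ)`. -/
def Etil {d : ℕ} (μ : Measure (Euc d)) (J : ℝ → ℝ) (α ε : ℝ)
    (χ : ℝ → ℝ → Euc d) : ℝ≥0∞ :=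
  ∫⁻ θ in Theta μ, ∫⁻ t in Set.Ici (0:ℝ),
    (Wtil μ J ε χ (χ θ t)) ^ (α - 1) * (‖deriv (χ θ) t‖₊ : ℝ≥0∞)

/-- The length of the path `c` on `[0, t]`. -/
def arcLen {d : ℕ} (c : ℝ → Euc d) (t : ℝ) : ℝ := ∫ u in (0 : ℝ)..t, ‖deriv c u‖

/-- The length of the path `c` on `[0, ∞)`. -/
def totLen {d : ℕ} (c : ℝ → Euc d) : ℝ := (∫⁻ u in Set.Ici (0 : ℝ), ‖deriv c u‖ₑ).toReal

/-- The first time at which a path `c` has covered the fraction `v` of its length. -/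
def fracTime {d : ℕ} (c : ℝ → Euc d) (v : ℝ) : ℝ :=
  sInf {t : ℝ | 0 ≤ t ∧ v * totLen c ≤ arcLen c t}

section Path

variable {d : ℕ} {c : ℝ → Euc d}

lemma norm_deriv_le_one (hc : LipschitzWith 1 c) (t : ℝ) : ‖deriv c t‖ ≤ 1 := by
  simpa using norm_deriv_le_of_lipschitz (x₀ := t) hc

lemma intervalIntegrable_norm_deriv (hc : LipschitzWith 1 c) (a b : ℝ) :
    IntervalIntegrable (fun u => ‖deriv c u‖) volume a b := by
  refine (intervalIntegrable_const (c := (1 : ℝ))).mono_fun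
    (measurable_deriv c).norm.aestronglyMeasurable (Eventually.of_forall fun t => ?_)
  simpa using norm_deriv_le_one hc t

lemma arcLen_sub (hc : LipschitzWith 1 c) (a b : ℝ) :
    arcLen c b - arcLen c a = ∫ u in a..b, ‖deriv c u‖ :=
  intervalIntegral.integral_interval_sub_left (intervalIntegrable_norm_deriv hc _ _)
    (intervalIntegrable_norm_deriv hc _ _)

lemma arcLen_zero : arcLen c 0 = 0 := by simp [arcLen]

lemma arcLen_mono (hc : LipschitzWith 1 c) : Monotone (arcLen c) := fun a b hab => by
  rw [← sub_nonneg, arcLen_sub hc]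
  exact intervalIntegral.integral_nonneg hab fun u _ => norm_nonneg _

lemma continuous_arcLen (hc : LipschitzWith 1 c) : Continuous (arcLen c) :=
  intervalIntegral.continuous_primitive (intervalIntegrable_norm_deriv hc) 0

lemma norm_sub_le_arcLen (hc : LipschitzWith 1 c) {a b : ℝ} (hab : a ≤ b) :
    ‖c b - c a‖ ≤ arcLen c b - arcLen c a := by
  set v := c b - c a with hv
  have hlip : LipschitzWith (‖innerSL ℝ v‖₊ * 1) (fun t => innerSL ℝ v (c t)) :=
    (innerSL ℝ v).lipschitz.comp hc
  have hac := (hlip.lipschitzOnWith (s := Set.uIcc a b)).absolutelyContinuousOnInterval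
  have h1 := hac.integral_deriv_eq_sub
  have h2 : ‖v‖ * ‖v‖ ≤ ∫ u in a..b, ‖v‖ * ‖deriv c u‖ := by
    have : ‖v‖ * ‖v‖ = innerSL ℝ v (c b) - innerSL ℝ v (c a) := by
      rw [← map_sub, ← hv, innerSL_apply_apply, real_inner_self_eq_norm_mul_norm]
    rw [this, ← h1]
    refine intervalIntegral.integral_mono_ae hab hac.intervalIntegrable_deriv
      ((intervalIntegrable_norm_deriv hc a b).const_mul _) ?_
    filter_upwards [hc.ae_differentiableAt_real] with t ht
    have : deriv (fun t => innerSL ℝ v (c t)) t = innerSL ℝ v (deriv c t) :=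
      ((innerSL ℝ v).hasFDerivAt.comp_hasDerivAt t ht.hasDerivAt).deriv
    rw [this]
    exact real_inner_le_norm v (deriv c t)
  rw [intervalIntegral.integral_const_mul, ← arcLen_sub hc] at h2
  rcases (norm_nonneg v).eq_or_lt with h | h
  · rw [← h]
    exact sub_nonneg.2 (arcLen_mono hc hab)
  · exact le_of_mul_le_mul_left h2 h

lemma dist_le_abs_arcLen (hc : LipschitzWith 1 c) (a b : ℝ) :
    dist (c a) (c b) ≤ |arcLen c a - arcLen c b| := by
  rcases le_total a b with h | h
  · rw [dist_comm, dist_eq_norm, abs_sub_comm]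
    exact (norm_sub_le_arcLen hc h).trans (le_abs_self _)
  · rw [dist_eq_norm]
    exact (norm_sub_le_arcLen hc h).trans (le_abs_self _)

lemma ofReal_arcLen_sub (hc : LipschitzWith 1 c) {a b : ℝ} (hab : a ≤ b) :
    ENNReal.ofReal (arcLen c b - arcLen c a) = ∫⁻ u in Set.Ioc a b, ‖deriv c u‖ₑ := by
  rw [arcLen_sub hc, intervalIntegral.integral_of_le hab, ofReal_integral_eq_lintegral_ofReal]
  · simp only [ofReal_norm]
  · exact ((intervalIntegrable_iff_integrableOn_Ioc_of_le hab).1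
      (intervalIntegrable_norm_deriv hc a b))
  · exact Eventually.of_forall fun _ => norm_nonneg _

lemma edist_le_lintegral (hc : LipschitzWith 1 c) {a b : ℝ} (hab : a ≤ b) :
    edist (c a) (c b) ≤ ∫⁻ u in Set.Ioc a b, ‖deriv c u‖ₑ := by
  rw [← ofReal_arcLen_sub hc hab, edist_dist, dist_comm, dist_eq_norm]
  exact ENNReal.ofReal_le_ofReal (norm_sub_le_arcLen hc hab)

lemma lintegral_Ici_eq_Ioc {c : ℝ → Euc d} {T : ℝ} (hT : 0 < T)
    (hconst : ∀ t ≥ T, c t = c T) (f : ℝ → ℝ≥0∞) :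
    ∫⁻ u in Set.Ici (0 : ℝ), f u * ‖deriv c u‖ₑ
      = ∫⁻ u in Set.Ioc (0 : ℝ) T, f u * ‖deriv c u‖ₑ := by
  rw [setLIntegral_congr (Ioi_ae_eq_Ici (a := (0 : ℝ)) (μ := volume)).symm,
    ← Set.Ioc_union_Ioi_eq_Ioi hT.le,
    lintegral_union measurableSet_Ioi (Set.Ioc_disjoint_Ioi le_rfl)]
  have : ∫⁻ u in Set.Ioi T, f u * ‖deriv c u‖ₑ = 0 := by
    rw [setLIntegral_congr_fun (g := fun _ => 0) measurableSet_Ioi]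
    · simp
    · intro t ht
      have : c =ᶠ[𝓝 t] fun _ => c T := by
        filter_upwards [Ioi_mem_nhds ht] with u hu using hconst u (le_of_lt hu)
      simp [this.deriv_eq]
  rw [this, add_zero]

lemma totLen_eq (hc : LipschitzWith 1 c) {T : ℝ} (hT : 0 < T)
    (hconst : ∀ t ≥ T, c t = c T) : totLen c = arcLen c T := by
  have := lintegral_Ici_eq_Ioc hT hconst (fun _ => 1)
  simp only [one_mul] at this
  rw [totLen, this, ← ofReal_arcLen_sub hc hT.le, arcLen_zero, sub_zero, ENNReal.toReal_ofReal]
  rw [← arcLen_zero (c := c)]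
  exact arcLen_mono hc hT.le

lemma ofReal_totLen (hc : LipschitzWith 1 c) {T : ℝ} (hT : 0 < T)
    (hconst : ∀ t ≥ T, c t = c T) :
    ENNReal.ofReal (totLen c) = ∫⁻ u in Set.Ici (0 : ℝ), ‖deriv c u‖ₑ := by
  have := lintegral_Ici_eq_Ioc hT hconst (fun _ => 1)
  simp only [one_mul] at this
  rw [this, ← ofReal_arcLen_sub hc hT.le, arcLen_zero, sub_zero, totLen_eq hc hT hconst]

/-- A path is at its final value at its stopping time. -/
lemma apply_sInf_of_eventuallyConst (hc : Continuous c) {T : ℝ} (hT : 0 < T)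
    (hconst : ∀ t ≥ T, c t = c T) :
    c (sInf {t : ℝ | 0 < t ∧ ∀ t' ≥ t, c t' = c t}) = c T := by
  set S := {t : ℝ | 0 < t ∧ ∀ t' ≥ t, c t' = c t}
  have hmem : sInf S ∈ closure S := csInf_mem_closure ⟨T, hT, hconst⟩ ⟨0, fun _ ht => ht.1.le⟩
  have hsub : S ⊆ {t | c t = c T} := fun t ht => by
    show c t = c T
    rw [← ht.2 (max t T) (le_max_left _ _), hconst _ (le_max_right _ _)]
  exact closure_minimal hsub (isClosed_eq hc continuous_const) hmem

section FracTime

variable {T : ℝ} {v : ℝ}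

lemma fracTime_mem (hc : LipschitzWith 1 c) (hT : 0 < T) (hconst : ∀ t ≥ T, c t = c T)
    (hv1 : v ≤ 1) :
    fracTime c v ∈ {t : ℝ | 0 ≤ t ∧ v * totLen c ≤ arcLen c t} := by
  refine IsClosed.csInf_mem ?_ ⟨T, hT.le, ?_⟩ ⟨0, fun _ ht => ht.1⟩
  · exact isClosed_Ici.inter (isClosed_le continuous_const (continuous_arcLen hc))
  · rw [← totLen_eq hc hT hconst]
    exact mul_le_of_le_one_left ENNReal.toReal_nonneg hv1

lemma fracTime_le_iff (hc : LipschitzWith 1 c) (hT : 0 < T) (hconst : ∀ t ≥ T, c t = c T)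
    (hv1 : v ≤ 1) {t : ℝ} (ht : 0 ≤ t) :
    fracTime c v ≤ t ↔ v * totLen c ≤ arcLen c t :=
  ⟨fun h => (fracTime_mem hc hT hconst hv1).2.trans (arcLen_mono hc h),
    fun h => csInf_le ⟨0, fun _ ht => ht.1⟩ ⟨ht, h⟩⟩

lemma arcLen_fracTime (hc : LipschitzWith 1 c) (hT : 0 < T) (hconst : ∀ t ≥ T, c t = c T)
    (hv0 : 0 ≤ v) (hv1 : v ≤ 1) : arcLen c (fracTime c v) = v * totLen c := by
  have hmem := fracTime_mem hc hT hconst hv1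
  refine le_antisymm ?_ hmem.2
  have h0 : v * totLen c ∈ Set.Icc (arcLen c 0) (arcLen c (fracTime c v)) :=
    ⟨by rw [arcLen_zero]; exact mul_nonneg hv0 ENNReal.toReal_nonneg, hmem.2⟩
  obtain ⟨t, ht, hte⟩ := intermediate_value_Icc hmem.1 (continuous_arcLen hc).continuousOn h0
  rw [← hte]
  exact arcLen_mono hc ((fracTime_le_iff hc hT hconst hv1 ht.1).2 hte.ge)

lemma fracTime_mono (hc : LipschitzWith 1 c) (hT : 0 < T) (hconst : ∀ t ≥ T, c t = c T)
    {v' : ℝ} (hv : v ≤ v') (hv' : v' ≤ 1) : fracTime c v ≤ fracTime c v' := by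
  have h := fracTime_mem hc hT hconst hv'
  refine (fracTime_le_iff hc hT hconst (hv.trans hv') h.1).2 (le_trans ?_ h.2)
  exact mul_le_mul_of_nonneg_right hv ENNReal.toReal_nonneg

lemma arcLen_le_totLen (hc : LipschitzWith 1 c) (hT : 0 < T) (hconst : ∀ t ≥ T, c t = c T)
    (t : ℝ) : arcLen c t ≤ totLen c := by
  have hT' : 0 < max t T := lt_max_of_lt_right hT
  rw [totLen_eq hc hT' fun u hu => ?_]
  · exact arcLen_mono hc (le_max_left _ _)
  · rw [hconst _ (le_max_right _ _), hconst _ ((le_max_right _ _).trans hu)]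

lemma dist_fracTime_le (hc : LipschitzWith 1 c) (hT : 0 < T) (hconst : ∀ t ≥ T, c t = c T)
    {v' : ℝ} (hv : v ∈ Set.Icc (0 : ℝ) 1) (hv' : v' ∈ Set.Icc (0 : ℝ) 1) :
    dist (c (fracTime c v)) (c (fracTime c v')) ≤ totLen c * dist v v' := by
  have h0 : 0 ≤ totLen c := ENNReal.toReal_nonneg
  refine (dist_le_abs_arcLen hc _ _).trans_eq ?_
  rw [arcLen_fracTime hc hT hconst hv.1 hv.2, arcLen_fracTime hc hT hconst hv'.1 hv'.2,
    ← sub_mul, abs_mul, abs_of_nonneg h0, mul_comm, Real.dist_eq]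

lemma apply_fracTime_of_arcLen_eq (hc : LipschitzWith 1 c) (hT : 0 < T)
    (hconst : ∀ t ≥ T, c t = c T) (hv0 : 0 ≤ v) (hv1 : v ≤ 1) {t : ℝ}
    (h : arcLen c t = v * totLen c) : c (fracTime c v) = c t := by
  rw [← dist_le_zero]
  refine (dist_le_abs_arcLen hc _ _).trans_eq ?_
  rw [arcLen_fracTime hc hT hconst hv0 hv1, h, sub_self, abs_zero]

lemma exists_fracTime_eq (hc : LipschitzWith 1 c) (hT : 0 < T)
    (hconst : ∀ t ≥ T, c t = c T) {t : ℝ} (ht : 0 ≤ t) :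
    arcLen c t / totLen c ∈ Set.Icc (0 : ℝ) 1 ∧
      c (fracTime c (arcLen c t / totLen c)) = c t := by
  have h0 : 0 ≤ arcLen c t := by
    rw [← arcLen_zero (c := c)]
    exact arcLen_mono hc ht
  have h1 := arcLen_le_totLen hc hT hconst t
  have hm : arcLen c t / totLen c ∈ Set.Icc (0 : ℝ) 1 :=
    ⟨div_nonneg h0 (h0.trans h1), div_le_one_of_le₀ h1 (h0.trans h1)⟩
  refine ⟨hm, apply_fracTime_of_arcLen_eq hc hT hconst hm.1 hm.2 ?_⟩
  rcases eq_or_ne (totLen c) 0 with h | h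
  · rw [h] at h1 ⊢
    rw [mul_zero]
    exact le_antisymm h1 h0
  · rw [div_mul_cancel₀ _ h]

end FracTime

end Path

lemma lintegral_le_liminf_of_jointly_continuous {X A : Type*} [TopologicalSpace X]
    [MeasurableSpace X] [OpensMeasurableSpace X] [HasOuterApproxClosed X] [TopologicalSpace A]
    {a : ℕ → A} {a₀ : A} (ha : Tendsto a atTop (𝓝 a₀))
    {P : ℕ → ProbabilityMeasure X} {P₀ : ProbabilityMeasure X} (hP : Tendsto P atTop (𝓝 P₀))
    {h : A → X → ℝ} (hh : Continuous (Function.uncurry h)) (hnn : ∀ a x, 0 ≤ h a x) :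
    ∫⁻ x, ENNReal.ofReal (h a₀ x) ∂(P₀ : Measure X)
      ≤ liminf (fun n => ∫⁻ x, ENNReal.ofReal (h (a n) x) ∂(P n : Measure X)) atTop := by
  have hcont : ∀ a, Continuous (h a) := fun a => hh.comp (by fun_prop : Continuous fun x => (a, x))
  have key : ∀ t : ℝ, (P₀ : Measure X) {x | t < h a₀ x}
      ≤ liminf (fun n => (P n : Measure X) {x | t < h (a n) x}) atTop := by
    intro t
    let V : ℕ → Set X := fun m => interior {x | ∀ n ≥ m, t < h (a n) x}
    have hVmono : Monotone V := fun m m' hm =>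
      interior_mono fun x hx n hn => hx n (le_trans hm hn)
    have hsub : {x | t < h a₀ x} ⊆ ⋃ m, V m := by
      intro x hx
      have hev : ∀ᶠ p : A × X in 𝓝 a₀ ×ˢ 𝓝 x, t < Function.uncurry h p := by
        rw [← nhds_prod_eq]
        exact hh.continuousAt.eventually (lt_mem_nhds hx)
      obtain ⟨pa, hpa, pb, hpb, hab⟩ := Filter.eventually_prod_iff.1 hev
      obtain ⟨m, hm⟩ := eventually_atTop.1 (ha.eventually hpa)
      refine Set.mem_iUnion.2 ⟨m, mem_interior_iff_mem_nhds.2 ?_⟩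
      filter_upwards [hpb] with y hy n hn using hab (hm n hn) hy
    calc (P₀ : Measure X) {x | t < h a₀ x} ≤ (P₀ : Measure X) (⋃ m, V m) := measure_mono hsub
      _ = ⨆ m, (P₀ : Measure X) (V m) := hVmono.measure_iUnion
      _ ≤ _ := iSup_le fun m => ?_
    refine (ProbabilityMeasure.le_liminf_measure_open_of_tendsto hP isOpen_interior).trans ?_
    refine liminf_le_liminf ?_
    filter_upwards [eventually_ge_atTop m] with n hn
    exact measure_mono fun x hx => interior_subset hx n hn
  simp_rw [fun a (Q : Measure X) => lintegral_eq_lintegral_meas_lt Q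
    (Eventually.of_forall (hnn a)) (hcont a).aemeasurable]
  refine (lintegral_mono key).trans (lintegral_liminf_le fun n => Antitone.measurable
    fun s t hst => measure_mono fun x hx => lt_of_le_of_lt hst hx)

/-- Curves parametrized by the unit interval. -/
abbrev Curve (d : ℕ) : Type := C(unitInterval, Euc d)

instance instMeasurableSpaceCurve (d : ℕ) : MeasurableSpace (Curve d) := borel _

instance instBorelSpaceCurve (d : ℕ) : BorelSpace (Curve d) := ⟨rfl⟩

section Curve

variable {d : ℕ}

lemma measurable_of_eval {β : Type*} [MeasurableSpace β] {f : β → Curve d}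
    (h : ∀ v, Measurable fun b => f b v) : Measurable f := by
  have hdist : ∀ γ : Curve d, Measurable fun b => dist (f b) γ := by
    intro γ
    refine measurable_of_Iic fun r => ?_
    rcases lt_or_ge r 0 with hr | hr
    · convert MeasurableSet.empty
      ext b
      simpa using hr.trans_le dist_nonneg
    · have : (fun b => dist (f b) γ) ⁻¹' Set.Iic r
          = ⋂ n : ℕ, {b | dist (f b (TopologicalSpace.denseSeq unitInterval n))
              (γ (TopologicalSpace.denseSeq unitInterval n)) ≤ r} := by
        ext b
        simp only [Set.mem_preimage, Set.mem_Iic, Set.mem_iInter, Set.mem_ofPred_eq]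
        rw [ContinuousMap.dist_le hr]
        refine ⟨fun H n => H _, fun H v => ?_⟩
        have hcl : IsClosed {v | dist (f b v) (γ v) ≤ r} :=
          isClosed_le (by fun_prop) continuous_const
        have hsub : Set.range (TopologicalSpace.denseSeq unitInterval)
            ⊆ {v | dist (f b v) (γ v) ≤ r} := by
          rintro _ ⟨n, rfl⟩
          exact H n
        exact closure_minimal hsub hcl (TopologicalSpace.denseRange_denseSeq _ v)
      rw [this]
      exact MeasurableSet.iInter fun n =>
        measurableSet_le ((h _).dist measurable_const) measurable_const
  refine measurable_of_isOpen fun s hs => ?_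
  obtain ⟨T, hTI, hT, hTs⟩ := TopologicalSpace.isOpen_biUnion_countable
    {p : Curve d × ℝ | Metric.ball p.1 p.2 ⊆ s} (fun p => Metric.ball p.1 p.2)
    (fun p _ => Metric.isOpen_ball)
  have hs' : s = ⋃ p ∈ T, Metric.ball p.1 p.2 := by
    rw [hTs]
    refine Set.Subset.antisymm (fun γ hγ => ?_) (Set.iUnion₂_subset fun p hp => hp)
    obtain ⟨r, hr, hrs⟩ := Metric.isOpen_iff.1 hs γ hγ
    exact Set.mem_biUnion (x := (γ, r)) hrs (Metric.mem_ball_self hr)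
  rw [hs', Set.preimage_iUnion₂]
  exact MeasurableSet.biUnion hT fun p _ => measurableSet_lt (hdist p.1) measurable_const

/-- The curves issued from the origin with Lipschitz constant `K`. -/
def lipSet (d K : ℕ) : Set (Curve d) := {γ | γ 0 = 0 ∧ LipschitzWith K γ}

lemma lipSet_mono : Monotone (lipSet d) := fun _ _ hK _ hγ =>
  ⟨hγ.1, hγ.2.weaken (by exact_mod_cast hK)⟩

lemma zero_mem_lipSet (K : ℕ) : (0 : Curve d) ∈ lipSet d K :=
  ⟨rfl, (LipschitzWith.const (0 : Euc d)).weaken zero_le⟩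

lemma isClosed_setOf_lipschitz (K : ℝ≥0) :
    IsClosed {f : unitInterval → Euc d | f 0 = 0 ∧ LipschitzWith K f} := by
  have : {f : unitInterval → Euc d | f 0 = 0 ∧ LipschitzWith K f} = {f | f 0 = 0} ∩
      ⋂ (s : unitInterval) (t : unitInterval), {f | dist (f s) (f t) ≤ K * dist s t} := by
    ext f
    simp only [lipschitzWith_iff_dist_le_mul, Set.mem_inter_iff, Set.mem_iInter,
      Set.mem_ofPred_eq]
  rw [this]
  refine (isClosed_eq (by fun_prop) continuous_const).inter
    (isClosed_iInter fun s => isClosed_iInter fun t => ?_)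
  exact isClosed_le (by fun_prop) continuous_const

lemma isClosed_lipSet (K : ℕ) : IsClosed (lipSet d K) :=
  (isClosed_setOf_lipschitz K).preimage (f := fun γ : Curve d => (γ : unitInterval → Euc d))
    (by fun_prop)

lemma isCompact_lipSet (K : ℕ) : IsCompact (lipSet d K) := by
  refine ArzelaAscoli.isCompact_of_equicontinuous _ ?_ ?_
  · have himg : ContinuousMap.toFun '' lipSet d K
        = {f : unitInterval → Euc d | f 0 = 0 ∧ LipschitzWith K f} := by
      ext f
      refine ⟨?_, fun hf => ⟨⟨f, hf.2.continuous⟩, hf, rfl⟩⟩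
      rintro ⟨γ, hγ, rfl⟩
      exact hγ
    rw [himg]
    refine (isCompact_univ_pi fun _ : unitInterval =>
      isCompact_closedBall (0 : Euc d) K).of_isClosed_subset (isClosed_setOf_lipschitz K) ?_
    intro f hf t _
    have h1 := hf.2.dist_le_mul t 0
    rw [hf.1] at h1
    refine h1.trans (mul_le_of_le_one_right (by positivity) ?_)
    rw [Subtype.dist_eq, Real.dist_eq, Set.Icc.coe_zero, sub_zero, abs_of_nonneg t.2.1]
    exact t.2.2
  · exact (LipschitzWith.uniformEquicontinuous _ (K : ℝ≥0) fun γ => γ.2.2).equicontinuous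

/-- The integrand of the mollified multiplicity, for curves. -/
def curveKernel (J : ℝ → ℝ) (ε : ℝ) (x : Euc d) (γ : Curve d) : ℝ :=
  J (Metric.infDist x (Set.range γ) / ε)

/-- The mollified multiplicity at `x` of a family of curves of total mass `m`, distributed
according to `P`. -/
def curveW (m : ℝ≥0∞) (J : ℝ → ℝ) (ε : ℝ) (P : Measure (Curve d)) (x : Euc d) : ℝ≥0∞ :=
  m * ∫⁻ γ, ENNReal.ofReal (curveKernel J ε x γ) ∂P

lemma abs_infDist_range_sub_le (x y : Euc d) (γ γ' : Curve d) :
    |Metric.infDist x (Set.range γ) - Metric.infDist y (Set.range γ')|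
      ≤ dist x y + dist γ γ' := by
  have key : ∀ (x y : Euc d) (γ γ' : Curve d), Metric.infDist x (Set.range γ)
      - Metric.infDist y (Set.range γ') ≤ dist x y + dist γ γ' := by
    intro x y γ γ'
    rw [sub_le_comm, Metric.le_infDist (Set.range_nonempty _)]
    rintro _ ⟨t, rfl⟩
    have h1 : Metric.infDist x (Set.range γ) ≤ dist x (γ t) :=
      Metric.infDist_le_dist_of_mem ⟨t, rfl⟩
    have h2 := dist_triangle4 x y (γ' t) (γ t)
    have h3 := ContinuousMap.dist_apply_le_dist (f := γ) (g := γ') t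
    rw [dist_comm (γ t)] at h3
    linarith
  rw [abs_sub_le_iff]
  refine ⟨key x y γ γ', ?_⟩
  have := key y x γ' γ
  rwa [dist_comm y, dist_comm γ'] at this

section Kernel

variable {J : ℝ → ℝ} {ε : ℝ}

lemma curveKernel_nonneg (hJ : MollKernel J) (hε : 0 < ε) (x : Euc d) (γ : Curve d) :
    0 ≤ curveKernel J ε x γ :=
  hJ.1 _ (div_nonneg Metric.infDist_nonneg hε.le)

lemma curveKernel_le_one (hJ : MollKernel J) (hε : 0 < ε) (x : Euc d) (γ : Curve d) :
    curveKernel J ε x γ ≤ 1 := by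
  have h0 : 0 ≤ Metric.infDist x (Set.range γ) / ε := div_nonneg Metric.infDist_nonneg hε.le
  rw [← hJ.2.2.2.1]
  exact hJ.2.1 (Set.mem_Ici.2 le_rfl) h0 h0

lemma exists_abs_curveKernel_sub_le (hJ : MollKernel J) (hε : 0 < ε) :
    ∃ C : ℝ, ∀ (x y : Euc d) (γ γ' : Curve d),
      |curveKernel J ε x γ - curveKernel J ε y γ'| ≤ C * (dist x y + dist γ γ') := by
  obtain ⟨K, hK⟩ := hJ.2.2.1
  refine ⟨K / ε, fun x y γ γ' => ?_⟩
  have h := hK.dist_le_mul _ (div_nonneg (Metric.infDist_nonneg (x := x) (s := Set.range γ)) hε.le)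
    _ (div_nonneg (Metric.infDist_nonneg (x := y) (s := Set.range γ')) hε.le)
  rw [Real.dist_eq, Real.dist_eq, ← sub_div, abs_div, abs_of_pos hε] at h
  refine h.trans ?_
  rw [← mul_div_assoc, div_mul_eq_mul_div]
  gcongr
  exact abs_infDist_range_sub_le x y γ γ'

lemma continuous_curveKernel (hJ : MollKernel J) (hε : 0 < ε) (x : Euc d) :
    Continuous (curveKernel J ε x) := by
  obtain ⟨C, hC⟩ := exists_abs_curveKernel_sub_le (d := d) hJ hε
  refine (LipschitzWith.of_dist_le' (K := C) fun γ γ' => ?_).continuous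
  simpa [Real.dist_eq] using hC x x γ γ'

lemma integrable_curveKernel (hJ : MollKernel J) (hε : 0 < ε) (x : Euc d)
    (P : Measure (Curve d)) [IsFiniteMeasure P] : Integrable (curveKernel J ε x) P := by
  refine Integrable.of_bound (continuous_curveKernel hJ hε x).aestronglyMeasurable 1
    (Eventually.of_forall fun γ => ?_)
  rw [Real.norm_of_nonneg (curveKernel_nonneg hJ hε x γ)]
  exact curveKernel_le_one hJ hε x γ

lemma continuous_integral_curveKernel (hJ : MollKernel J) (hε : 0 < ε) :
    Continuous fun p : ProbabilityMeasure (Curve d) × Euc d =>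
      ∫ γ, curveKernel J ε p.2 γ ∂(p.1 : Measure (Curve d)) := by
  obtain ⟨C, hC⟩ := exists_abs_curveKernel_sub_le (d := d) hJ hε
  rw [continuous_iff_continuousAt]
  rintro ⟨P₀, x₀⟩
  let φ : BoundedContinuousFunction (Curve d) ℝ :=
    BoundedContinuousFunction.ofNormedAddCommGroup (curveKernel J ε x₀)
      (continuous_curveKernel hJ hε x₀) 1 fun γ => by
        rw [Real.norm_of_nonneg (curveKernel_nonneg hJ hε x₀ γ)]
        exact curveKernel_le_one hJ hε x₀ γ
  have h1 : Tendsto (fun P : ProbabilityMeasure (Curve d) =>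
      ∫ γ, curveKernel J ε x₀ γ ∂(P : Measure (Curve d))) (𝓝 P₀)
      (𝓝 (∫ γ, curveKernel J ε x₀ γ ∂(P₀ : Measure (Curve d)))) :=
    (ProbabilityMeasure.tendsto_iff_forall_integral_tendsto.1 tendsto_id) φ
  have h2 : Tendsto (fun p : ProbabilityMeasure (Curve d) × Euc d =>
      ∫ γ, curveKernel J ε x₀ γ ∂(p.1 : Measure (Curve d))) (𝓝 (P₀, x₀))
      (𝓝 (∫ γ, curveKernel J ε x₀ γ ∂(P₀ : Measure (Curve d)))) :=
    h1.comp continuousAt_fst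
  have h3 : Tendsto (fun p : ProbabilityMeasure (Curve d) × Euc d =>
      ∫ γ, curveKernel J ε p.2 γ ∂(p.1 : Measure (Curve d))
        - ∫ γ, curveKernel J ε x₀ γ ∂(p.1 : Measure (Curve d))) (𝓝 (P₀, x₀)) (𝓝 0) := by
    refine squeeze_zero_norm (a := fun p => C * dist p.2 x₀) (fun p => ?_) ?_
    · rw [← integral_sub (integrable_curveKernel hJ hε _ _) (integrable_curveKernel hJ hε _ _)]
      refine (norm_integral_le_of_norm_le_const (C := C * dist p.2 x₀)
        (Eventually.of_forall fun γ => ?_)).trans_eq (by simp)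
      simpa [Real.norm_eq_abs] using hC p.2 x₀ γ γ
    · have : Continuous fun p : ProbabilityMeasure (Curve d) × Euc d => C * dist p.2 x₀ := by
        fun_prop
      simpa using this.tendsto (P₀, x₀)
  simpa [ContinuousAt] using h3.add h2

lemma continuous_curveW {m : ℝ≥0∞} (hm : m ≠ ∞) (hJ : MollKernel J) (hε : 0 < ε) :
    Continuous fun p : ProbabilityMeasure (Curve d) × Euc d =>
      curveW m J ε (p.1 : Measure (Curve d)) p.2 := by
  have : (fun p : ProbabilityMeasure (Curve d) × Euc d =>
      curveW m J ε (p.1 : Measure (Curve d)) p.2) = fun p => m * ENNReal.ofReal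
        (∫ γ, curveKernel J ε p.2 γ ∂(p.1 : Measure (Curve d))) := by
    ext p
    rw [curveW, ofReal_integral_eq_lintegral_ofReal (integrable_curveKernel hJ hε _ _)
      (Eventually.of_forall fun γ => curveKernel_nonneg hJ hε _ γ)]
  rw [this]
  exact (ENNReal.continuous_const_mul hm).comp
    (ENNReal.continuous_ofReal.comp (continuous_integral_curveKernel hJ hε))

end Kernel

/-- The `i`-th cell of the subdivision of the unit interval into `N` intervals. -/
def cell (N i : ℕ) : Set unitInterval := {t | (i : ℝ) / N ≤ t ∧ (t : ℝ) ≤ (i + 1 : ℕ) / N}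

/-- The `i`-th node of the subdivision of the unit interval into `N` intervals. -/
def node (N i : ℕ) : unitInterval := Set.projIcc 0 1 zero_le_one ((i : ℝ) / N)

/-- A truncated weight of the `i`-th cell of the subdivision of a curve into `k + 1` arcs. -/
def cellWeight (β : ℝ) (w : Euc d → ℝ≥0∞) (k : ℕ) (γ : Curve d) (i : ℕ) : ℝ≥0∞ :=
  min (sSup ((fun t => w (γ t)) '' cell (k + 1) i) ^ β) k

/-- A polygonal lower approximation of the weighted length `∫ w(γ)^β |γ'|`. -/
def polyCost (β : ℝ) (w : Euc d → ℝ≥0∞) (k : ℕ) (γ : Curve d) : ℝ≥0∞ :=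
  ∑ i ∈ Finset.range (k + 1),
    cellWeight β w k γ i * edist (γ (node (k + 1) i)) (γ (node (k + 1) (i + 1)))

lemma isCompact_cell (N i : ℕ) : IsCompact (cell N i) :=
  ((isClosed_le continuous_const continuous_subtype_val).inter
    (isClosed_le continuous_subtype_val continuous_const)).isCompact

lemma cellWeight_ne_top (β : ℝ) (w : Euc d → ℝ≥0∞) (k : ℕ) (γ : Curve d) (i : ℕ) :
    cellWeight β w k γ i ≠ ∞ :=
  ((min_le_right _ _).trans_lt (ENNReal.natCast_lt_top k)).ne

lemma polyCost_ne_top (β : ℝ) (w : Euc d → ℝ≥0∞) (k : ℕ) (γ : Curve d) :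
    polyCost β w k γ ≠ ∞ :=
  ENNReal.sum_ne_top.2 fun i _ =>
    ENNReal.mul_ne_top (cellWeight_ne_top β w k γ i) (edist_ne_top _ _)

lemma continuous_polyCost {A : Type*} [TopologicalSpace A] (β : ℝ) {w : A → Euc d → ℝ≥0∞}
    (hw : Continuous (Function.uncurry w)) (k : ℕ) :
    Continuous fun p : A × Curve d => polyCost β (w p.1) k p.2 := by
  refine continuous_finsetSum _ fun i _ => Continuous.ennreal_mul ?_ (by fun_prop)
    (fun p => Or.inr (edist_ne_top _ _)) (fun p => Or.inr (cellWeight_ne_top _ _ _ _ _))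
  refine (ENNReal.continuous_rpow_const.comp ?_).min continuous_const
  refine (isCompact_cell (k + 1) i).continuous_sSup
    (f := fun (p : A × Curve d) t => w p.1 (p.2 t)) ?_
  exact hw.comp (f := fun q : (A × Curve d) × unitInterval => (q.1.1, q.1.2 q.2)) (by fun_prop)

end Curve

section Compress

lemma rpow_le_rpow_of_exponent_nonpos {β : ℝ} (hβ : β ≤ 0) {a b : ℝ≥0∞} (h : a ≤ b) :
    b ^ β ≤ a ^ β := by
  rw [← neg_neg β, ENNReal.rpow_neg, ENNReal.rpow_neg a]
  exact ENNReal.inv_le_inv.2 (ENNReal.rpow_le_rpow h (neg_nonneg.2 hβ))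

variable {d : ℕ} {c : ℝ → Euc d} {T : ℝ} {γ : Curve d}

lemma exists_curve_fracTime (hc : LipschitzWith 1 c) (hT : 0 < T)
    (hconst : ∀ t ≥ T, c t = c T) : ∃ γ : Curve d, ∀ v, γ v = c (fracTime c v) := by
  have h : LipschitzWith (totLen c).toNNReal fun v : unitInterval => c (fracTime c v) :=
    LipschitzWith.of_dist_le' fun v v' => dist_fracTime_le hc hT hconst v.2 v'.2
  exact ⟨⟨_, h.continuous⟩, fun _ => rfl⟩

lemma lipschitzWith_curve (hc : LipschitzWith 1 c) (hT : 0 < T)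
    (hconst : ∀ t ≥ T, c t = c T) (hγ : ∀ v, γ v = c (fracTime c v)) :
    LipschitzWith (totLen c).toNNReal γ :=
  LipschitzWith.of_dist_le' fun v v' => by
    rw [hγ, hγ]
    exact dist_fracTime_le hc hT hconst v.2 v'.2

lemma curve_apply_zero (hc : LipschitzWith 1 c) (hT : 0 < T)
    (hconst : ∀ t ≥ T, c t = c T) (hγ : ∀ v, γ v = c (fracTime c v)) : γ 0 = c 0 := by
  rw [hγ]
  exact apply_fracTime_of_arcLen_eq hc hT hconst le_rfl zero_le_one
    (by rw [arcLen_zero, zero_mul])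

lemma curve_apply_one (hc : LipschitzWith 1 c) (hT : 0 < T)
    (hconst : ∀ t ≥ T, c t = c T) (hγ : ∀ v, γ v = c (fracTime c v)) : γ 1 = c T := by
  rw [hγ]
  exact apply_fracTime_of_arcLen_eq hc hT hconst zero_le_one le_rfl
    (by rw [totLen_eq hc hT hconst, one_mul])

lemma range_curve (hc : LipschitzWith 1 c) (hT : 0 < T)
    (hconst : ∀ t ≥ T, c t = c T) (hγ : ∀ v, γ v = c (fracTime c v)) :
    Set.range γ = c '' Set.Ici 0 := by
  ext x
  constructor
  · rintro ⟨v, rfl⟩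
    exact ⟨fracTime c v, (fracTime_mem hc hT hconst v.2.2).1, (hγ v).symm⟩
  · rintro ⟨t, ht, rfl⟩
    obtain ⟨hm, he⟩ := exists_fracTime_eq hc hT hconst ht
    exact ⟨⟨_, hm⟩, (hγ _).trans he⟩

lemma coe_node {N i : ℕ} (hi : i ≤ N) (hN : 0 < N) : (node N i : ℝ) = (i : ℝ) / N := by
  rw [node, Set.projIcc_of_mem zero_le_one ⟨by positivity, ?_⟩]
  exact div_le_one_of_le₀ (by exact_mod_cast hi) (by positivity)

lemma sum_lintegral_Ioc {f : ℝ → ℝ≥0∞} {a : ℕ → ℝ} (n : ℕ) (ha : ∀ i < n, a i ≤ a (i + 1)) :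
    a 0 ≤ a n ∧ ∑ i ∈ Finset.range n, ∫⁻ t in Set.Ioc (a i) (a (i + 1)), f t
      = ∫⁻ t in Set.Ioc (a 0) (a n), f t := by
  induction n with
  | zero => simp
  | succ n ih =>
    obtain ⟨h1, h2⟩ := ih fun i hi => ha i (hi.trans n.lt_succ_self)
    have h3 := ha n n.lt_succ_self
    refine ⟨h1.trans h3, ?_⟩
    rw [Finset.sum_range_succ, h2, ← Set.Ioc_union_Ioc_eq_Ioc h1 h3,
      lintegral_union measurableSet_Ioc (Set.Ioc_disjoint_Ioc_of_le le_rfl)]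

lemma sum_lintegral_Ioc_le {f : ℝ → ℝ≥0∞} {a : ℕ → ℝ} (n : ℕ)
    (ha : ∀ i < n, a i ≤ a (i + 1)) (ha0 : 0 ≤ a 0) :
    ∑ i ∈ Finset.range n, ∫⁻ t in Set.Ioc (a i) (a (i + 1)), f t
      ≤ ∫⁻ t in Set.Ici (0 : ℝ), f t := by
  rw [(sum_lintegral_Ioc n ha).2]
  exact lintegral_mono_set fun t ht => ha0.trans ht.1.le

lemma polyCost_le_lintegral (hc : LipschitzWith 1 c) (hT : 0 < T)
    (hconst : ∀ t ≥ T, c t = c T) (hγ : ∀ v, γ v = c (fracTime c v))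
    {β : ℝ} (hβ : β ≤ 0) (w : Euc d → ℝ≥0∞) (k : ℕ) :
    polyCost β w k γ ≤ ∫⁻ t in Set.Ici (0 : ℝ), w (c t) ^ β * ‖deriv c t‖ₑ := by
  rcases (ENNReal.toReal_nonneg : 0 ≤ totLen c).eq_or_lt with hL | hL
  · have hconstγ : ∀ u v, γ u = γ v := fun u v => by
      have := (lipschitzWith_curve hc hT hconst hγ).dist_le_mul u v
      rw [totLen, ← hL] at this
      simpa using this
    have : polyCost β w k γ = 0 := Finset.sum_eq_zero fun i _ => by
      rw [hconstγ (node (k + 1) i) (node (k + 1) (i + 1)), edist_self, mul_zero]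
    rw [this]
    exact zero_le
  set a : ℕ → ℝ := fun i => fracTime c (node (k + 1) i) with ha
  have hcell : ∀ i < k + 1, ∀ t ∈ Set.Ioc (a i) (a (i + 1)),
      cellWeight β w k γ i ≤ w (c t) ^ β := by
    intro i hi t ht
    have h0 : 0 ≤ t := (fracTime_mem hc hT hconst (node (k + 1) i).2.2).1.trans ht.1.le
    obtain ⟨hm, he⟩ := exists_fracTime_eq hc hT hconst h0
    have h1 := arcLen_mono hc ht.1.le
    have h2 := arcLen_mono hc ht.2
    rw [ha, arcLen_fracTime hc hT hconst (node _ _).2.1 (node _ _).2.2,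
      coe_node (by lia) (by lia)] at h1 h2
    refine (min_le_left _ _).trans (rpow_le_rpow_of_exponent_nonpos hβ (le_sSup ?_))
    refine ⟨⟨_, hm⟩, ⟨?_, ?_⟩, ?_⟩
    · exact (le_div_iff₀ hL).2 h1
    · exact (div_le_iff₀ hL).2 h2
    · simp only [hγ, he]
  have hstep : ∀ i < k + 1, a i ≤ a (i + 1) := fun i hi => by
    refine fracTime_mono hc hT hconst ?_ (node _ _).2.2
    rw [coe_node (by lia) (by lia), coe_node (by lia) (by lia)]
    gcongr
    lia
  refine le_trans (Finset.sum_le_sum fun i hi => ?_)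
    (sum_lintegral_Ioc_le (k + 1) hstep (fracTime_mem hc hT hconst (node _ _).2.2).1)
  rw [Finset.mem_range] at hi
  rw [hγ, hγ]
  refine (mul_le_mul_right (edist_le_lintegral hc (hstep i hi)) _).trans ?_
  rw [← lintegral_const_mul _ (measurable_deriv c).enorm]
  exact setLIntegral_mono' measurableSet_Ioc fun t ht => mul_le_mul_left (hcell i hi t ht) _

end Compress

section Family

variable {d : ℕ} {χ : ℝ → ℝ → Euc d} {S : Set ℝ}

lemma exists_measurable_speed (hχ : Measurable (Function.uncurry χ))
    (hlip : ∀ θ ∈ S, LipschitzWith 1 (χ θ)) :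
    ∃ D : ℝ × ℝ → ℝ≥0∞, Measurable D ∧
      ∀ θ ∈ S, ∀ᵐ t, D (θ, t) = ‖deriv (χ θ) t‖ₑ := by
  let q : ℕ → ℝ × ℝ → Euc d := fun n p =>
    (1 / ((n : ℝ) + 1))⁻¹ • (χ p.1 (p.2 + 1 / ((n : ℝ) + 1)) - χ p.1 p.2)
  have hq : ∀ n, Measurable (q n) := fun n => by
    have h1 : Measurable fun p : ℝ × ℝ => χ p.1 (p.2 + 1 / ((n : ℝ) + 1)) :=
      hχ.comp (measurable_fst.prodMk (measurable_snd.add_const _))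
    have h2 : Measurable fun p : ℝ × ℝ => χ p.1 p.2 := hχ
    exact (h1.sub h2).const_smul ((1 / ((n : ℝ) + 1))⁻¹)
  refine ⟨fun p => limsup (fun n => ‖q n p‖ₑ) atTop, Measurable.limsup fun n => (hq n).enorm, ?_⟩
  intro θ hθ
  filter_upwards [(hlip θ hθ).ae_differentiableAt_real] with t ht
  have h1 := ht.hasDerivAt.tendsto_slope_zero
  have h2 : Tendsto (fun n : ℕ => 1 / ((n : ℝ) + 1)) atTop (𝓝[≠] 0) :=
    tendsto_nhdsWithin_iff.2 ⟨tendsto_one_div_add_atTop_nhds_zero_nat,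
      Eventually.of_forall fun n => by
        have : 0 < 1 / ((n : ℝ) + 1) := by positivity
        exact this.ne'⟩
  exact ((continuous_enorm.tendsto _).comp (h1.comp h2)).limsup_eq

lemma exists_curve_family (hS : MeasurableSet S) (hχ : Measurable (Function.uncurry χ))
    (hlip : ∀ θ ∈ S, LipschitzWith 1 (χ θ))
    (hev : ∀ θ ∈ S, ∃ t, 0 < t ∧ ∀ t' ≥ t, χ θ t' = χ θ t) :
    ∃ Γ : ℝ → Curve d, Measurable Γ ∧
      ∀ θ ∈ S, ∀ v, Γ θ v = χ θ (fracTime (χ θ) v) := by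
  classical
  obtain ⟨D, hD, hDeq⟩ := exists_measurable_speed hχ hlip
  choose! T hT hconst using hev
  have hex : ∀ θ, ∃ γ : Curve d, (θ ∈ S → ∀ v, γ v = χ θ (fracTime (χ θ) v)) ∧
      (θ ∉ S → γ = 0) := fun θ => by
    by_cases hθ : θ ∈ S
    · obtain ⟨γ, hγ⟩ := exists_curve_fracTime (hlip θ hθ) (hT θ hθ) (hconst θ hθ)
      exact ⟨γ, fun _ => hγ, fun h => absurd hθ h⟩
    · exact ⟨0, fun h => absurd h hθ, fun _ => rfl⟩
  choose Γ hΓ hΓ' using hex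
  refine ⟨Γ, measurable_of_eval fun v => ?_, fun θ hθ => hΓ θ hθ⟩
  have hDint : ∀ A : Set ℝ, Measurable fun θ => ∫⁻ u in A, D (θ, u) := fun A =>
    hD.lintegral_prod_right'
  have htot : ∀ θ ∈ S, totLen (χ θ) = (∫⁻ u in Set.Ici (0 : ℝ), D (θ, u)).toReal :=
    fun θ hθ => by
      rw [totLen, setLIntegral_congr_fun_ae measurableSet_Ici
        ((hDeq θ hθ).mono fun t ht _ => ht)]
  have harc : ∀ θ ∈ S, ∀ t, 0 ≤ t →
      arcLen (χ θ) t = (∫⁻ u in Set.Ioc (0 : ℝ) t, D (θ, u)).toReal := fun θ hθ t ht => by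
    rw [setLIntegral_congr_fun_ae measurableSet_Ioc ((hDeq θ hθ).mono fun t ht _ => ht),
      ← ofReal_arcLen_sub (hlip θ hθ) ht, arcLen_zero, sub_zero, ENNReal.toReal_ofReal]
    rw [← arcLen_zero (c := χ θ)]
    exact arcLen_mono (hlip θ hθ) ht
  have hσ : Measurable fun θ => if θ ∈ S then fracTime (χ θ) v else 0 := by
    refine measurable_of_Iic fun t => ?_
    rcases lt_or_ge t 0 with ht | ht
    · convert MeasurableSet.empty
      ext θ
      simp only [Set.mem_preimage, Set.mem_Iic, Set.mem_empty_iff_false, iff_false, not_le]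
      split_ifs with hθ
      · exact ht.trans_le (fracTime_mem (hlip θ hθ) (hT θ hθ) (hconst θ hθ) v.2.2).1
      · exact ht
    · have : (fun θ => if θ ∈ S then fracTime (χ θ) v else 0) ⁻¹' Set.Iic t
          = Sᶜ ∪ (S ∩ {θ | (v : ℝ) * (∫⁻ u in Set.Ici (0 : ℝ), D (θ, u)).toReal
            ≤ (∫⁻ u in Set.Ioc (0 : ℝ) t, D (θ, u)).toReal}) := by
        ext θ
        by_cases hθ : θ ∈ S
        · simp only [Set.mem_preimage, hθ, if_true, Set.mem_Iic, Set.mem_union,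
            Set.mem_compl_iff, not_true_eq_false, false_or, Set.mem_inter_iff, true_and,
            Set.mem_ofPred_eq]
          rw [fracTime_le_iff (hlip θ hθ) (hT θ hθ) (hconst θ hθ) v.2.2 ht, htot θ hθ,
            harc θ hθ t ht]
        · simp [hθ, ht]
      rw [this]
      exact hS.compl.union (hS.inter (measurableSet_le
        ((hDint _).ennreal_toReal.const_mul _) (hDint _).ennreal_toReal))
  have hcomp : (fun θ => Γ θ v)
      = fun θ => if θ ∈ S then χ θ (if θ ∈ S then fracTime (χ θ) v else 0) else 0 := by
    ext1 θ
    by_cases hθ : θ ∈ S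
    · simp only [hθ, if_true, hΓ θ hθ v]
    · simp only [hθ, if_false, hΓ' θ hθ, ContinuousMap.zero_apply]
  rw [hcomp]
  exact Measurable.ite hS (hχ.comp (measurable_id.prodMk hσ)) measurable_const

end Family

section CurvePath

variable {d : ℕ}

/-- The path on the half-line that runs through the curve `γ` during `[0, K]` and then stops. -/
def curvePath (K : ℝ) (γ : Curve d) (t : ℝ) : Euc d := γ (Set.projIcc 0 1 zero_le_one (t / K))

variable {K : ℕ} {γ : Curve d}

lemma lipschitzWith_curvePath (hK : 0 < K) (hγ : LipschitzWith K γ) :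
    LipschitzWith 1 (curvePath K γ) := by
  have hK' : (0 : ℝ) < K := by exact_mod_cast hK
  refine LipschitzWith.of_dist_le_mul fun s t => ?_
  have h1 := hγ.dist_le_mul (Set.projIcc 0 1 zero_le_one (s / K))
    (Set.projIcc 0 1 zero_le_one (t / K))
  have h2 := (LipschitzWith.projIcc (zero_le_one' ℝ)).dist_le_mul (s / K) (t / K)
  refine h1.trans ?_
  rw [NNReal.coe_one, one_mul] at h2 ⊢
  calc ((K : ℝ≥0) : ℝ) * _ ≤ K * dist (s / K) (t / K) := by
        rw [NNReal.coe_natCast]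
        gcongr
    _ = dist s t := by
        rw [Real.dist_eq, Real.dist_eq, ← sub_div, abs_div, abs_of_pos hK']
        field_simp

lemma curvePath_zero : curvePath K γ 0 = γ 0 := by
  rw [curvePath, zero_div, Set.projIcc_left]
  rfl

lemma curvePath_of_ge (hK : 0 < K) {t : ℝ} (ht : (K : ℝ) ≤ t) : curvePath K γ t = γ 1 := by
  have hK' : (0 : ℝ) < K := by exact_mod_cast hK
  rw [curvePath, Set.projIcc_of_right_le zero_le_one ((one_le_div hK').2 ht)]
  rfl

lemma image_curvePath (hK : 0 < K) : curvePath K γ '' Set.Ici 0 = Set.range γ := by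
  have hK' : (0 : ℝ) < K := by exact_mod_cast hK
  ext x
  constructor
  · rintro ⟨t, -, rfl⟩
    exact ⟨_, rfl⟩
  · rintro ⟨v, rfl⟩
    refine ⟨v * K, mul_nonneg v.2.1 hK'.le, ?_⟩
    rw [curvePath, mul_div_cancel_right₀ _ hK'.ne', Set.projIcc_val]

lemma curvePath_node (hK : 0 < K) (N i : ℕ) : curvePath K γ (i / N * K) = γ (node N i) := by
  have hK' : (0 : ℝ) < K := by exact_mod_cast hK
  rw [curvePath, mul_div_cancel_right₀ _ hK'.ne', node]

/-- Slopes over intervals shrinking to `t` converge to the speed at `t`. -/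
lemma tendsto_edist_div_of_straddle {c : ℝ → Euc d} {t : ℝ} (hc : DifferentiableAt ℝ c t)
    {a b : ℕ → ℝ} (ha : ∀ n, a n ≤ t) (hb : ∀ n, t ≤ b n) (hab : ∀ n, a n < b n)
    (hlim : Tendsto (fun n => b n - a n) atTop (𝓝 0)) :
    Tendsto (fun n => edist (c (a n)) (c (b n)) / ENNReal.ofReal (b n - a n)) atTop
      (𝓝 ‖deriv c t‖ₑ) := by
  have hat : Tendsto a atTop (𝓝 t) := by
    refine tendsto_of_tendsto_of_tendsto_of_le_of_le (g := fun n => t - (b n - a n))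
      (by simpa using tendsto_const_nhds.sub hlim) tendsto_const_nhds (fun n => ?_) ha
    have := hb n
    simp only
    linarith
  have hbt : Tendsto b atTop (𝓝 t) := by simpa using hlim.add hat
  have hslope : Tendsto (fun n => (b n - a n)⁻¹ • (c (b n) - c (a n))) atTop
      (𝓝 (deriv c t)) := by
    rw [Metric.tendsto_atTop]
    intro δ hδ
    have hlo := hasDerivAt_iff_isLittleO.1 hc.hasDerivAt
    have hev := hlo.def (half_pos hδ)
    obtain ⟨n₀, hn₀⟩ := eventually_atTop.1 ((hat.eventually hev).and (hbt.eventually hev))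
    refine ⟨n₀, fun n hn => ?_⟩
    obtain ⟨h1, h2⟩ := hn₀ n hn
    have hpos : 0 < b n - a n := sub_pos.2 (hab n)
    rw [Real.norm_eq_abs, abs_of_nonpos (sub_nonpos.2 (ha n))] at h1
    rw [Real.norm_eq_abs, abs_of_nonneg (sub_nonneg.2 (hb n))] at h2
    have heq : (b n - a n)⁻¹ • (c (b n) - c (a n)) - deriv c t = (b n - a n)⁻¹ •
        ((c (b n) - c t - (b n - t) • deriv c t) - (c (a n) - c t - (a n - t) • deriv c t)) := by
      have : deriv c t = (b n - a n)⁻¹ • ((b n - a n) • deriv c t) := by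
        rw [smul_smul, inv_mul_cancel₀ hpos.ne', one_smul]
      nth_rewrite 1 [this]
      rw [← smul_sub]
      congr 1
      module
    rw [dist_eq_norm, heq, norm_smul, Real.norm_of_nonneg (inv_nonneg.2 hpos.le),
      inv_mul_lt_iff₀ hpos]
    refine (norm_sub_le _ _).trans_lt ?_
    nlinarith
  refine ((continuous_enorm.tendsto _).comp hslope).congr fun n => ?_
  have hpos : 0 < b n - a n := sub_pos.2 (hab n)
  rw [Function.comp_apply, enorm_smul, edist_comm, edist_eq_enorm_sub, ENNReal.div_eq_inv_mul,
    enorm_inv hpos.ne', Real.enorm_of_nonneg hpos.le]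

/-- Continuity of the cell weights along shrinking cells. -/
lemma le_liminf_cellWeight {w : Euc d → ℝ≥0∞} (hw : Continuous w) (β : ℝ) (γ : Curve d)
    {i : ℕ → ℕ} {v : unitInterval} (hv : ∀ k, v ∈ cell (k + 1) (i k)) :
    w (γ v) ^ β ≤ liminf (fun k => cellWeight β w k γ (i k)) atTop := by
  refine le_of_forall_lt fun r hr => ?_
  obtain ⟨r', hrr', hr'⟩ := exists_between hr
  refine hrr'.trans_le (le_liminf_of_le (by isBoundedDefault) ?_)
  have hopen : IsOpen {u : unitInterval | r' < w (γ u) ^ β} :=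
    isOpen_lt continuous_const
      (ENNReal.continuous_rpow_const.comp (hw.comp γ.continuous))
  obtain ⟨δ, hδ, hball⟩ := Metric.isOpen_iff.1 hopen v hr'
  have h1 : ∀ᶠ k : ℕ in atTop, 1 / ((k : ℝ) + 1) < δ :=
    tendsto_one_div_add_atTop_nhds_zero_nat.eventually (gt_mem_nhds hδ)
  have h2 : ∀ᶠ k : ℕ in atTop, r' < k :=
    ENNReal.tendsto_nat_nhds_top.eventually (lt_mem_nhds (hr'.trans_le le_top))
  filter_upwards [h1, h2] with k hk1 hk2
  refine le_min ?_ hk2.le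
  obtain ⟨u, hu, hsup⟩ := (isCompact_cell (k + 1) (i k)).exists_sSup_image_eq ⟨v, hv k⟩
    (f := fun t => w (γ t)) (hw.comp γ.continuous).continuousOn
  rw [hsup]
  refine le_of_lt (hball ?_)
  have hv' := hv k
  simp only [cell, Set.mem_ofPred_eq] at hu hv'
  have h3 : ((i k + 1 : ℕ) : ℝ) / (k + 1 : ℕ) = (i k : ℝ) / (k + 1 : ℕ) + 1 / ((k : ℝ) + 1) := by
    push_cast
    ring
  rw [h3] at hu hv'
  rw [Metric.mem_ball, Subtype.dist_eq, Real.dist_eq, abs_sub_lt_iff]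
  constructor <;> linarith [hu.1, hu.2, hv'.1, hv'.2]

lemma lintegral_curvePath_le (hK : 0 < K) (hγ : LipschitzWith K γ) {w : Euc d → ℝ≥0∞}
    (hw : Continuous w) (β : ℝ) :
    ∫⁻ t in Set.Ici (0 : ℝ), w (curvePath K γ t) ^ β * ‖deriv (curvePath K γ) t‖ₑ
      ≤ liminf (fun k => polyCost β w k γ) atTop := by
  have hK' : (0 : ℝ) < K := by exact_mod_cast hK
  have hc := lipschitzWith_curvePath hK hγ
  let a : ℕ → ℕ → ℝ := fun k i => (i : ℝ) / (k + 1 : ℕ) * K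
  have hastep : ∀ k i, a k (i + 1) - a k i = K * (1 / ((k : ℝ) + 1)) := fun k i => by
    simp only [a]
    push_cast
    ring
  have halt : ∀ k i, a k i < a k (i + 1) := fun k i => by
    rw [← sub_pos, hastep]
    positivity
  let q : ℕ → ℕ → ℝ≥0∞ := fun k i => cellWeight β w k γ i *
    (edist (curvePath K γ (a k i)) (curvePath K γ (a k (i + 1)))
      / ENNReal.ofReal (a k (i + 1) - a k i))
  let idx : ℕ → ℝ → ℕ := fun k t => ⌈((k + 1 : ℕ) : ℝ) * (t / K)⌉₊ - 1
  have hidx : ∀ k i t, t ∈ Set.Ioc (a k i) (a k (i + 1)) → idx k t = i := fun k i t ht => by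
    have : ⌈((k + 1 : ℕ) : ℝ) * (t / K)⌉₊ = i + 1 := by
      have h1 := ht.1
      have h2 := ht.2
      simp only [a] at h1 h2
      rw [← lt_div_iff₀ hK', div_lt_iff₀ (by positivity)] at h1
      rw [← div_le_iff₀ hK', le_div_iff₀ (by positivity)] at h2
      rw [Nat.ceil_eq_iff (Nat.add_one_ne_zero i), Nat.add_sub_cancel, mul_comm]
      exact ⟨h1, h2⟩
    simp only [idx, this, Nat.add_sub_cancel]
  have hmem : ∀ k, ∀ t ∈ Set.Ioc (0 : ℝ) K, t ∈ Set.Ioc (a k (idx k t)) (a k (idx k t + 1)) :=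
    fun k t ht => by
    have hpos : 0 < ((k + 1 : ℕ) : ℝ) * (t / K) := mul_pos (by positivity) (div_pos ht.1 hK')
    have hne : ⌈((k + 1 : ℕ) : ℝ) * (t / K)⌉₊ ≠ 0 := (Nat.ceil_pos.2 hpos).ne'
    obtain ⟨h1, h2⟩ := (Nat.ceil_eq_iff hne).1 rfl
    have h3 : idx k t + 1 = ⌈((k + 1 : ℕ) : ℝ) * (t / K)⌉₊ :=
      Nat.sub_add_cancel (Nat.one_le_iff_ne_zero.2 hne)
    simp only [a, h3]
    constructor
    · rw [← lt_div_iff₀ hK', div_lt_iff₀ (by positivity), mul_comm]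
      exact h1
    · rw [← div_le_iff₀ hK', le_div_iff₀ (by positivity), mul_comm]
      exact h2
  have hint : ∀ k, ∫⁻ t in Set.Ioc (0 : ℝ) K, q k (idx k t) = polyCost β w k γ := fun k => by
    have h0 : a k 0 = 0 := by simp [a]
    have h1 : a k (k + 1) = K := by
      simp only [a]
      rw [div_self (by positivity), one_mul]
    rw [← h0, ← h1, ← (sum_lintegral_Ioc (k + 1) fun i _ => (halt k i).le).2]
    refine Finset.sum_congr rfl fun i _ => ?_
    rw [setLIntegral_congr_fun measurableSet_Ioc fun t ht => by rw [hidx k i t ht],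
      setLIntegral_const, Real.volume_Ioc, mul_assoc, ENNReal.div_mul_cancel
        (ENNReal.ofReal_pos.2 (sub_pos.2 (halt k i))).ne' ENNReal.ofReal_ne_top,
      curvePath_node hK, curvePath_node hK]
  have hmeas : ∀ k, Measurable fun t => q k (idx k t) := fun k => by
    have h1 : Measurable fun t : ℝ => ⌈((k + 1 : ℕ) : ℝ) * (t / K)⌉₊ :=
      Nat.measurable_ceil.comp (by fun_prop)
    exact (measurable_from_top (f := fun n => q k (n - 1))).comp h1
  rw [lintegral_Ici_eq_Ioc hK' (fun t ht => by
    rw [curvePath_of_ge hK ht, curvePath_of_ge hK le_rfl])]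
  simp_rw [← hint]
  refine le_trans ?_ (lintegral_liminf_le hmeas)
  refine lintegral_mono_ae ?_
  filter_upwards [ae_restrict_mem measurableSet_Ioc,
    ae_restrict_of_ae hc.ae_differentiableAt_real] with t ht hdiff
  refine le_trans (mul_le_mul' ?_ (le_of_eq ?_)) ENNReal.le_liminf_mul
  · refine le_liminf_cellWeight hw β γ fun k => ?_
    have hv : (Set.projIcc (0 : ℝ) 1 zero_le_one (t / K) : ℝ) = t / K := by
      rw [Set.projIcc_of_mem zero_le_one
        ⟨div_nonneg ht.1.le hK'.le, div_le_one_of_le₀ ht.2 hK'.le⟩]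
    obtain ⟨h1, h2⟩ := hmem k t ht
    simp only [cell, Set.mem_ofPred_eq, hv]
    exact ⟨(le_div_iff₀ hK').2 h1.le, (div_le_iff₀ hK').2 h2⟩
  · refine (tendsto_edist_div_of_straddle hdiff (fun k => (hmem k t ht).1.le)
      (fun k => (hmem k t ht).2) (fun k => halt k _) ?_).liminf_eq.symm
    simp only [hastep]
    simpa using tendsto_one_div_add_atTop_nhds_zero_nat.const_mul (K : ℝ)

end CurvePath

section Plans

variable {d : ℕ} {μ : Measure (Euc d)}

lemma measurableSet_Theta : MeasurableSet (Theta μ) := measurableSet_Icc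

lemma volume_Theta [IsFiniteMeasure μ] : volume (Theta μ) = μ Set.univ := by
  rw [Theta, Real.volume_Icc, sub_zero, ENNReal.ofReal_toReal (measure_ne_top μ _)]

lemma pathInfDist_eq_infDist (χ : ℝ → ℝ → Euc d) (θ : ℝ) (x : Euc d) :
    pathInfDist χ θ x = Metric.infDist x (χ θ '' Set.Ici 0) := by
  rw [Metric.infDist_eq_iInf, pathInfDist, ← sInf_image' (f := fun y => dist x y),
    ← sInf_image' (f := fun t => dist (χ θ t) x), Set.image_image]
  simp_rw [dist_comm x]

lemma continuous_curveW_apply {m : ℝ≥0∞} (hm : m ≠ ∞) {J : ℝ → ℝ} (hJ : MollKernel J) {ε : ℝ}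
    (hε : 0 < ε) (P : ProbabilityMeasure (Curve d)) :
    Continuous (curveW m J ε (P : Measure (Curve d))) :=
  (continuous_curveW hm hJ hε).comp (f := fun x => (P, x)) (by fun_prop)

lemma continuous_polyCost_apply {w : Euc d → ℝ≥0∞} (hw : Continuous w) (β : ℝ) (k : ℕ) :
    Continuous (polyCost β w k) :=
  (continuous_polyCost (A := Unit) β (w := fun _ => w)
    (hw.comp continuous_snd) k).comp
      (f := fun γ => ((), γ)) (by fun_prop)

lemma Wmol_eq_curveW {χ : ℝ → ℝ → Euc d} {Γ : ℝ → Curve d} (hΓ : Measurable Γ) {m : ℝ≥0∞}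
    {P : Measure (Curve d)} (hmap : (volume.restrict (Theta μ)).map Γ = m • P)
    (hrange : ∀ θ ∈ Theta μ, χ θ '' Set.Ici 0 = Set.range (Γ θ))
    {J : ℝ → ℝ} (hJ : MollKernel J) {ε : ℝ} (hε : 0 < ε) :
    Wmol μ J ε χ = curveW m J ε P := by
  ext x
  have h1 : Wmol μ J ε χ x
      = ∫⁻ θ in Theta μ, ENNReal.ofReal (curveKernel J ε x (Γ θ)) :=
    setLIntegral_congr_fun measurableSet_Theta fun θ hθ => by
      simp only [curveKernel, pathInfDist_eq_infDist, hrange θ hθ]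
  rw [h1, ← lintegral_map (f := fun γ => ENNReal.ofReal (curveKernel J ε x γ))
    (continuous_curveKernel hJ hε x).measurable.ennreal_ofReal hΓ, hmap,
    lintegral_smul_measure, curveW, smul_eq_mul]

lemma exists_measurable_map_volume_eq {X : Type*} [MeasurableSpace X] [StandardBorelSpace X]
    [Nonempty X] (P : Measure X) [IsProbabilityMeasure P] {M : ℝ} (hM : 0 < M) :
    ∃ Γ : ℝ → X, Measurable Γ ∧
      (volume.restrict (Set.Icc 0 M)).map Γ = ENNReal.ofReal M • P := by
  obtain ⟨f, hf, hfP⟩ := Measure.exists_measurable_map_eq P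
  have hΓ : Measurable fun θ : ℝ => f (Set.projIcc 0 1 zero_le_one (M⁻¹ * θ)) :=
    hf.comp (continuous_projIcc.measurable.comp (measurable_id.const_mul _))
  refine ⟨_, hΓ, Measure.ext fun s hs => ?_⟩
  rw [Measure.map_apply hΓ hs, Measure.restrict_apply (hΓ hs), Measure.smul_apply, ← hfP,
    Measure.map_apply hf hs, smul_eq_mul]
  have hset : (fun θ : ℝ => f (Set.projIcc 0 1 zero_le_one (M⁻¹ * θ))) ⁻¹' s ∩ Set.Icc 0 M
      = (M⁻¹ * ·) ⁻¹' (Subtype.val '' (f ⁻¹' s)) := by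
    have hmem : ∀ θ : ℝ, θ ∈ Set.Icc 0 M ↔ M⁻¹ * θ ∈ Set.Icc (0 : ℝ) 1 := fun θ => by
      rw [Set.mem_Icc, Set.mem_Icc, inv_mul_le_one₀ hM]
      refine and_congr_left fun _ => ?_
      rw [mul_nonneg_iff_of_pos_left (inv_pos.2 hM)]
    ext θ
    constructor
    · rintro ⟨h1, h2⟩
      rw [hmem] at h2
      refine ⟨⟨_, h2⟩, ?_, rfl⟩
      rwa [Set.mem_preimage, Set.projIcc_of_mem zero_le_one h2] at h1
    · rintro ⟨v, hv, hvθ⟩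
      simp only at hvθ
      refine ⟨?_, (hmem θ).2 (hvθ ▸ v.2)⟩
      rwa [Set.mem_preimage, ← hvθ, Set.projIcc_val]
  rw [hset, Real.volume_preimage_mul_left (inv_pos.2 hM).ne', inv_inv, abs_of_pos hM,
    volume_image_subtype_coe measurableSet_Icc]

lemma exists_family_of_measure (P : Measure (Curve d)) [IsProbabilityMeasure P]
    (hP : P (⋃ K, lipSet d K)ᶜ = 0) {M : ℝ} (hM : 0 < M) :
    ∃ (Γ : ℝ → Curve d) (K : ℝ → ℕ), Measurable Γ ∧ Measurable K ∧ (∀ θ, 0 < K θ) ∧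
      (∀ θ, Γ θ ∈ lipSet d (K θ)) ∧
      (volume.restrict (Set.Icc 0 M)).map Γ = ENNReal.ofReal M • P := by
  classical
  obtain ⟨Γ₀, hΓ₀, hmap⟩ := exists_measurable_map_volume_eq P hM
  have hG : MeasurableSet (⋃ K, lipSet d K) :=
    MeasurableSet.iUnion fun K => (isClosed_lipSet K).measurableSet
  let Γ : ℝ → Curve d := fun θ => if Γ₀ θ ∈ ⋃ K, lipSet d K then Γ₀ θ else 0
  have hΓ : Measurable Γ := Measurable.ite (hΓ₀ hG) hΓ₀ measurable_const
  have hex : ∀ θ, ∃ n, Γ θ ∈ lipSet d (n + 1) := fun θ => by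
    by_cases h : Γ₀ θ ∈ ⋃ K, lipSet d K
    · obtain ⟨n, hn⟩ := Set.mem_iUnion.1 h
      refine ⟨n, ?_⟩
      simp only [Γ, h, if_true]
      exact lipSet_mono n.le_succ hn
    · refine ⟨0, ?_⟩
      simp only [Γ, h, if_false]
      exact zero_mem_lipSet _
  refine ⟨Γ, fun θ => Nat.find (hex θ) + 1, hΓ, ?_, fun θ => Nat.succ_pos _,
    fun θ => Nat.find_spec (hex θ), ?_⟩
  · exact (measurable_find hex fun n => hΓ (isClosed_lipSet (n + 1)).measurableSet).add_const 1
  · rw [← hmap]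
    refine Measure.map_congr ?_
    have h0 : (volume.restrict (Set.Icc 0 M)) (Γ₀ ⁻¹' (⋃ K, lipSet d K)ᶜ) = 0 := by
      rw [← Measure.map_apply hΓ₀ hG.compl, hmap, Measure.smul_apply, hP, smul_zero]
    filter_upwards [measure_eq_zero_iff_ae_notMem.1 h0] with θ hθ
    have h : Γ₀ θ ∈ ⋃ K, lipSet d K := by simpa using hθ
    simp only [Γ, h, if_true]

/-- A measure on curves is realized by an irrigation plan of no larger cost. -/
lemma exists_plan_of_measure [IsFiniteMeasure μ] (hμ : μ Set.univ ≠ 0)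
    (P : ProbabilityMeasure (Curve d)) (hP : (P : Measure (Curve d)) (⋃ K, lipSet d K)ᶜ = 0)
    (hP1 : μ Set.univ • (P : Measure (Curve d)).map (fun γ => γ 1) = μ)
    {J : ℝ → ℝ} (hJ : MollKernel J) {ε : ℝ} (hε : 0 < ε) (α : ℝ) :
    ∃ χ : ℝ → ℝ → Euc d, IsIrrigPlan μ χ ∧ Emol μ J α ε χ ≤ μ Set.univ *
      ∫⁻ γ, liminf (fun k => polyCost (α - 1) (curveW (μ Set.univ) J ε P) k γ) atTop
        ∂(P : Measure (Curve d)) := by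
  have hfin := measure_ne_top μ Set.univ
  obtain ⟨Γ, K, hΓ, hK, hKpos, hlip, hmap⟩ :=
    exists_family_of_measure (P : Measure (Curve d)) hP (ENNReal.toReal_pos hμ hfin)
  rw [ENNReal.ofReal_toReal hfin] at hmap
  change (volume.restrict (Theta μ)).map Γ = _ at hmap
  let χ : ℝ → ℝ → Euc d := fun θ => curvePath (K θ) (Γ θ)
  have hχconst : ∀ θ, ∀ t ≥ (K θ : ℝ), χ θ t = χ θ (K θ) := fun θ t ht => by
    simp only [χ, curvePath_of_ge (hKpos θ) ht, curvePath_of_ge (hKpos θ) le_rfl]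
  have hχlip : ∀ θ, LipschitzWith 1 (χ θ) := fun θ => lipschitzWith_curvePath (hKpos θ) (hlip θ).2
  have hKpos' : ∀ θ, (0 : ℝ) < K θ := fun θ => by exact_mod_cast hKpos θ
  have hcurve : Continuous (curveW (μ Set.univ) J ε (P : Measure (Curve d))) :=
    continuous_curveW_apply hfin hJ hε P
  refine ⟨χ, ⟨?_, fun θ _ => hχlip θ, fun θ _ => ⟨K θ, hKpos' θ, hχconst θ⟩, fun θ _ => ?_, ?_⟩,
    ?_⟩
  · have h1 : Measurable fun p : ℝ × ℝ =>
        (Γ p.1, (Set.projIcc 0 1 zero_le_one (p.2 / K p.1) : unitInterval)) := by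
      refine (hΓ.comp measurable_fst).prodMk (continuous_projIcc.measurable.comp ?_)
      exact measurable_snd.div ((measurable_from_top (f := fun n : ℕ => (n : ℝ))).comp
        (hK.comp measurable_fst))
    have h2 : Continuous fun q : Curve d × unitInterval => q.1 q.2 := by fun_prop
    exact h2.measurable.comp h1
  · simp only [χ, curvePath_zero]
    exact (hlip θ).1
  · have h1 : (fun θ => χ θ (stopTime χ θ)) = (fun γ : Curve d => γ 1) ∘ Γ := by
      ext1 θ
      rw [stopTime, apply_sInf_of_eventuallyConst (hχlip θ).continuous (hKpos' θ) (hχconst θ)]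
      exact curvePath_of_ge (hKpos θ) le_rfl
    rw [h1, ← Measure.map_map (continuous_eval_const 1).measurable hΓ, hmap, Measure.map_smul, hP1]
  · rw [← smul_eq_mul, ← lintegral_smul_measure, ← hmap, lintegral_map (Measurable.liminf
      fun k => (continuous_polyCost_apply hcurve _ k).measurable) hΓ, Emol,
      Wmol_eq_curveW hΓ hmap (fun θ _ => image_curvePath (hKpos θ)) hJ hε]
    exact lintegral_mono fun θ => lintegral_curvePath_le (hKpos θ) (hlip θ).2 hcurve _

lemma Wmol_le [IsFiniteMeasure μ] {J : ℝ → ℝ} (hJ : MollKernel J) {ε : ℝ} (hε : 0 < ε)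
    (χ : ℝ → ℝ → Euc d) (x : Euc d) : Wmol μ J ε χ x ≤ μ Set.univ := by
  rw [← volume_Theta (μ := μ), ← setLIntegral_one]
  refine lintegral_mono fun θ => ENNReal.ofReal_le_one.2 ?_
  have h0 : 0 ≤ pathInfDist χ θ x / ε := by
    rw [pathInfDist_eq_infDist]
    exact div_nonneg Metric.infDist_nonneg hε.le
  rw [← hJ.2.2.2.1]
  exact hJ.2.1 (Set.mem_Ici.2 le_rfl) h0 h0

/-- An irrigation plan induces a measure on curves of no larger cost, with a quantitative bound
on the mass of the curves of large Lipschitz constant. -/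
lemma exists_measure_of_plan [IsFiniteMeasure μ] (hμ : μ Set.univ ≠ 0) {χ : ℝ → ℝ → Euc d}
    (hχ : IsIrrigPlan μ χ) {J : ℝ → ℝ} (hJ : MollKernel J) {ε : ℝ} (hε : 0 < ε) {α : ℝ}
    (hα : α ≤ 1) :
    ∃ P : ProbabilityMeasure (Curve d),
      μ Set.univ • (P : Measure (Curve d)).map (fun γ => γ 1) = μ ∧
      (∀ k, μ Set.univ * ∫⁻ γ, polyCost (α - 1) (curveW (μ Set.univ) J ε P) k γ
        ∂(P : Measure (Curve d)) ≤ Emol μ J α ε χ) ∧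
      ∀ K : ℕ, μ Set.univ ^ (α - 1) * K *
        (μ Set.univ * (P : Measure (Curve d)) (lipSet d K)ᶜ) ≤ Emol μ J α ε χ := by
  have hfin := measure_ne_top μ Set.univ
  have hα' : α - 1 ≤ 0 := sub_nonpos.2 hα
  obtain ⟨Γ, hΓ, hΓχ⟩ :=
    exists_curve_family measurableSet_Theta hχ.measurable hχ.lipschitz hχ.eventuallyConst
  have hprob : IsProbabilityMeasure
      ((μ Set.univ)⁻¹ • (volume.restrict (Theta μ)).map Γ) := ⟨by
    rw [Measure.smul_apply, Measure.map_apply hΓ MeasurableSet.univ, Set.preimage_univ,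
      Measure.restrict_apply_univ, volume_Theta, smul_eq_mul, ENNReal.inv_mul_cancel hμ hfin]⟩
  let P : ProbabilityMeasure (Curve d) := ⟨_, hprob⟩
  have hmap : (volume.restrict (Theta μ)).map Γ = μ Set.univ • (P : Measure (Curve d)) := by
    change _ = μ Set.univ • ((μ Set.univ)⁻¹ • (volume.restrict (Theta μ)).map Γ)
    rw [smul_smul, ENNReal.mul_inv_cancel hμ hfin, one_smul]
  have hW : Wmol μ J ε χ = curveW (μ Set.univ) J ε P :=
    Wmol_eq_curveW hΓ hmap (fun θ hθ => by
      obtain ⟨T, hT, hconst⟩ := hχ.eventuallyConst θ hθ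
      exact (range_curve (hχ.lipschitz θ hθ) hT hconst (hΓχ θ hθ)).symm) hJ hε
  have hcurve := continuous_curveW_apply hfin hJ hε P
  refine ⟨P, ?_, fun k => ?_, fun K => ?_⟩
  · rw [← Measure.map_smul, ← hmap, Measure.map_map (continuous_eval_const 1).measurable hΓ]
    refine (Measure.map_congr ?_).trans hχ.pushforward
    filter_upwards [ae_restrict_mem measurableSet_Theta] with θ hθ
    obtain ⟨T, hT, hconst⟩ := hχ.eventuallyConst θ hθ
    rw [stopTime, apply_sInf_of_eventuallyConst (hχ.lipschitz θ hθ).continuous hT hconst]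
    exact curve_apply_one (hχ.lipschitz θ hθ) hT hconst (hΓχ θ hθ)
  · rw [← smul_eq_mul, ← lintegral_smul_measure, ← hmap,
      lintegral_map (continuous_polyCost_apply hcurve _ k).measurable hΓ, Emol, hW]
    refine setLIntegral_mono' measurableSet_Theta fun θ hθ => ?_
    obtain ⟨T, hT, hconst⟩ := hχ.eventuallyConst θ hθ
    exact polyCost_le_lintegral (hχ.lipschitz θ hθ) hT hconst (hΓχ θ hθ) hα' _ k
  · have hS : MeasurableSet (lipSet d K)ᶜ := (isClosed_lipSet K).measurableSet.compl
    rw [← smul_eq_mul (μ Set.univ), ← Measure.smul_apply, ← hmap, Measure.map_apply hΓ hS,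
      ← lintegral_indicator_const (hΓ hS), Emol]
    refine setLIntegral_mono' measurableSet_Theta fun θ hθ => ?_
    obtain ⟨T, hT, hconst⟩ := hχ.eventuallyConst θ hθ
    have hlip := hχ.lipschitz θ hθ
    by_cases hθK : θ ∈ Γ ⁻¹' (lipSet d K)ᶜ
    swap
    · rw [Set.indicator_of_notMem hθK]
      exact zero_le
    rw [Set.indicator_of_mem hθK]
    have hK : (K : ℝ≥0∞) ≤ ∫⁻ u in Set.Ici 0, ‖deriv (χ θ) u‖ₑ := by
      by_contra! hlt
      rw [← ofReal_totLen hlip hT hconst, ← ENNReal.ofReal_natCast] at hlt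
      refine hθK ⟨(curve_apply_zero hlip hT hconst (hΓχ θ hθ)).trans (hχ.init θ hθ),
        (lipschitzWith_curve hlip hT hconst (hΓχ θ hθ)).weaken ?_⟩
      rw [Real.toNNReal_le_iff_le_coe, NNReal.coe_natCast]
      exact (ENNReal.ofReal_le_ofReal_iff K.cast_nonneg).1 hlt.le
    refine (mul_le_mul' le_rfl hK).trans ?_
    rw [← lintegral_const_mul _ (measurable_deriv _).enorm]
    exact lintegral_mono fun t =>
      mul_le_mul' (rpow_le_rpow_of_exponent_nonpos hα' (Wmol_le hJ hε χ _)) le_rfl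

end Plans

section Existence

variable {d : ℕ} {μ : Measure (Euc d)}

lemma exists_subseq_tendsto {P : ℕ → ProbabilityMeasure (Curve d)} {C : ℝ≥0}
    (hC : ∀ n (K : ℕ), K * P n (lipSet d K)ᶜ ≤ C) :
    ∃ (P₀ : ProbabilityMeasure (Curve d)) (φ : ℕ → ℕ), StrictMono φ ∧
      Tendsto (P ∘ φ) atTop (𝓝 P₀) ∧ (P₀ : Measure (Curve d)) (⋃ K, lipSet d K)ᶜ = 0 := by
  have hu : Tendsto (fun n : ℕ => C / ((n + 1 : ℕ) : ℝ≥0)) atTop (𝓝 0) :=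
    (tendsto_add_atTop_iff_nat (f := fun n : ℕ => C / (n : ℝ≥0)) 1).2
      (NNReal.tendsto_coe.1 (by simpa using tendsto_const_div_atTop_nhds_zero_nat (C : ℝ)))
  have hcomp : IsCompact {Q : ProbabilityMeasure (Curve d) |
      ∀ n : ℕ, Q (lipSet d (n + 1))ᶜ ≤ C / ((n + 1 : ℕ) : ℝ≥0)} :=
    isCompact_setOfPred_probabilityMeasure_mass_eq_compl_isCompact_le hu
      (fun n => isCompact_lipSet (n + 1)) (Or.inr fun m n hmn => lipSet_mono (by lia))
  let := TopologicalSpace.metrizableSpaceMetric (ProbabilityMeasure (Curve d))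
  obtain ⟨P₀, hP₀, φ, hφ, hlim⟩ := hcomp.tendsto_subseq (x := P) fun n K => by
    rw [le_div_iff₀' (by positivity)]
    exact hC n (K + 1)
  refine ⟨P₀, φ, hφ, hlim, ?_⟩
  have hle : ∀ n : ℕ, P₀ (⋃ K, lipSet d K)ᶜ ≤ C / ((n + 1 : ℕ) : ℝ≥0) := fun n =>
    (ProbabilityMeasure.apply_mono P₀
      (Set.compl_subset_compl.2 (Set.subset_iUnion _ (n + 1)))).trans (hP₀ n)
  rw [← ProbabilityMeasure.ennreal_coeFn_eq_coeFn_toMeasure, ENNReal.coe_eq_zero]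
  exact le_antisymm (ge_of_tendsto' hu hle) zero_le

lemma map_eval_one_of_tendsto {P : ℕ → ProbabilityMeasure (Curve d)}
    {P₀ : ProbabilityMeasure (Curve d)} (hlim : Tendsto P atTop (𝓝 P₀)) {ν : Measure (Euc d)}
    (hP : ∀ n, (P n : Measure (Curve d)).map (fun γ => γ 1) = ν) :
    (P₀ : Measure (Curve d)).map (fun γ => γ 1) = ν := by
  have hcont : Continuous fun γ : Curve d => γ 1 := continuous_eval_const 1
  have h := ProbabilityMeasure.tendsto_map_of_tendsto_of_continuous P P₀ hlim hcont
  have hconst : ∀ n, (P n).map hcont.measurable.aemeasurable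
      = (P 0).map hcont.measurable.aemeasurable := fun n =>
    Subtype.ext ((hP n).trans (hP 0).symm)
  simp_rw [hconst] at h
  have := tendsto_nhds_unique h tendsto_const_nhds
  rw [← hP 0]
  exact congrArg (fun Q : ProbabilityMeasure (Euc d) => (Q : Measure (Euc d))) this

/-- Lower semicontinuity of the cost of a measure on curves. -/
lemma lintegral_liminf_polyCost_le {P : ℕ → ProbabilityMeasure (Curve d)}
    {P₀ : ProbabilityMeasure (Curve d)} (hlim : Tendsto P atTop (𝓝 P₀)) {m : ℝ≥0∞} (hm : m ≠ ∞)
    {J : ℝ → ℝ} (hJ : MollKernel J) {ε : ℝ} (hε : 0 < ε) (β : ℝ) {b : ℕ → ℝ≥0∞} {B : ℝ≥0∞}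
    (hb : Tendsto b atTop (𝓝 B))
    (hPb : ∀ k n, ∫⁻ γ, polyCost β (curveW m J ε (P n)) k γ ∂(P n : Measure (Curve d)) ≤ b n) :
    ∫⁻ γ, liminf (fun k => polyCost β (curveW m J ε P₀) k γ) atTop ∂(P₀ : Measure (Curve d))
      ≤ B := by
  refine (lintegral_liminf_le fun k => (continuous_polyCost_apply
    (continuous_curveW_apply hm hJ hε P₀) β k).measurable).trans ?_
  refine liminf_le_of_frequently_le' (Frequently.of_forall fun k => ?_)
  have hcont : Continuous (Function.uncurry fun (Q : ProbabilityMeasure (Curve d)) γ =>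
      (polyCost β (curveW m J ε (Q : Measure (Curve d))) k γ).toReal) := by
    refine ENNReal.continuousOn_toReal.comp_continuous
      (f := fun p : ProbabilityMeasure (Curve d) × Curve d =>
        polyCost β (curveW m J ε (p.1 : Measure (Curve d))) k p.2) ?_
      fun p => polyCost_ne_top _ _ _ _
    exact continuous_polyCost β (w := fun Q : ProbabilityMeasure (Curve d) =>
      curveW m J ε (Q : Measure (Curve d))) (continuous_curveW hm hJ hε) k
  have h := lintegral_le_liminf_of_jointly_continuous hlim hlim hcont
    fun _ _ => ENNReal.toReal_nonneg
  simp only [ENNReal.ofReal_toReal (polyCost_ne_top _ _ _ _)] at h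
  exact h.trans ((liminf_le_liminf (Eventually.of_forall (hPb k))).trans_eq hb.liminf_eq)

/-- Compactness and lower semicontinuity of the mollified cost: a convergent sequence of finite
costs bounds from above the cost of some plan. -/
lemma exists_plan_of_tendsto_Emol [IsFiniteMeasure μ] (hμ : μ Set.univ ≠ 0) {J : ℝ → ℝ}
    (hJ : MollKernel J) {ε : ℝ} (hε : 0 < ε) {α : ℝ} (hα : α ≤ 1) {χ : ℕ → ℝ → ℝ → Euc d}
    (hχ : ∀ n, IsIrrigPlan μ (χ n)) {B : ℝ≥0∞}
    (hlim : Tendsto (fun n => Emol μ J α ε (χ n)) atTop (𝓝 B)) {B' : ℝ≥0∞} (hB' : B' ≠ ∞)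
    (hbd : ∀ n, Emol μ J α ε (χ n) ≤ B') :
    ∃ χ₀ : ℝ → ℝ → Euc d, IsIrrigPlan μ χ₀ ∧ Emol μ J α ε χ₀ ≤ B := by
  have hfin := measure_ne_top μ Set.univ
  choose P hP1 hPcost hPtail using fun n => exists_measure_of_plan hμ (hχ n) hJ hε hα
  have ha0 : μ Set.univ ^ (α - 1) * μ Set.univ ≠ 0 :=
    mul_ne_zero (ENNReal.rpow_pos (pos_iff_ne_zero.2 hμ) hfin).ne' hμ
  have hatop : μ Set.univ ^ (α - 1) * μ Set.univ ≠ ∞ :=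
    ENNReal.mul_ne_top (ENNReal.rpow_ne_top_of_ne_zero hμ hfin) hfin
  have htail : ∀ n (K : ℕ),
      K * P n (lipSet d K)ᶜ ≤ (B' / (μ Set.univ ^ (α - 1) * μ Set.univ)).toNNReal := by
    intro n K
    rw [← ENNReal.coe_le_coe, ENNReal.coe_toNNReal (ENNReal.div_ne_top hB' ha0),
      ENNReal.le_div_iff_mul_le (Or.inl ha0) (Or.inl hatop), ENNReal.coe_mul,
      ENNReal.coe_natCast, ProbabilityMeasure.ennreal_coeFn_eq_coeFn_toMeasure]
    refine le_trans (le_of_eq ?_) ((hPtail n K).trans (hbd n))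
    ring
  obtain ⟨P₀, φ, hφ, hPlim, hP₀⟩ := exists_subseq_tendsto htail
  have hmapn : ∀ n, ((P ∘ φ) n : Measure (Curve d)).map (fun γ => γ 1) = (μ Set.univ)⁻¹ • μ :=
    fun n => by
    refine Eq.trans ?_ (congrArg ((μ Set.univ)⁻¹ • ·) (hP1 (φ n)))
    simp only [smul_smul, ENNReal.inv_mul_cancel hμ hfin, one_smul, Function.comp_apply]
  have hmap := map_eval_one_of_tendsto hPlim hmapn
  obtain ⟨χ₀, hχ₀, hcost⟩ := exists_plan_of_measure hμ P₀ hP₀ (by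
    rw [hmap, smul_smul, ENNReal.mul_inv_cancel hμ hfin, one_smul]) hJ hε α
  refine ⟨χ₀, hχ₀, hcost.trans ?_⟩
  rw [mul_comm, ← ENNReal.le_div_iff_mul_le (Or.inl hμ) (Or.inl hfin)]
  refine lintegral_liminf_polyCost_le hPlim hfin hJ hε _
    (ENNReal.Tendsto.div_const (hlim.comp hφ.tendsto_atTop) (Or.inr hμ)) fun k n => ?_
  rw [ENNReal.le_div_iff_mul_le (Or.inl hμ) (Or.inl hfin), mul_comm]
  exact hPcost (φ n) k

end Existence

/-- existence of a global minimizer of the mollified irrigation cost. -/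
theorem exists_minimizer_mollified_cost {d : ℕ} (hd : 1 ≤ d)
    (μ : Measure (Euc d)) [IsFiniteMeasure μ]
    (hsupp : ∃ R : ℝ, μ (Metric.closedBall 0 R)ᶜ = 0)
    (J : ℝ → ℝ) (hJ : MollKernel J) (ε : ℝ) (hε : 0 < ε)
    (α : ℝ) (hα : α ∈ Set.Icc (0:ℝ) 1)
    (hne : ∃ χ : ℝ → ℝ → Euc d, IsIrrigPlan μ χ) :
    ∃ χ : ℝ → ℝ → Euc d, IsIrrigPlan μ χ ∧
      ∀ χ' : ℝ → ℝ → Euc d, IsIrrigPlan μ χ' → Emol μ J α ε χ ≤ Emol μ J α ε χ' := by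
  by_cases hμ : μ Set.univ = 0
  · obtain ⟨χ, hχ⟩ := hne
    refine ⟨χ, hχ, fun χ' _ => ?_⟩
    have h0 : Emol μ J α ε χ = 0 :=
      setLIntegral_measure_zero _ _ (by rw [volume_Theta, hμ])
    rw [h0]
    exact zero_le
  let S : Set ℝ≥0∞ := Emol μ J α ε '' {χ | IsIrrigPlan μ χ}
  have hS : S.Nonempty := Set.Nonempty.image _ hne
  suffices h : ∃ χ : ℝ → ℝ → Euc d, IsIrrigPlan μ χ ∧ Emol μ J α ε χ ≤ sInf S by
    obtain ⟨χ, hχ, hle⟩ := h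
    exact ⟨χ, hχ, fun χ' hχ' => hle.trans (sInf_le ⟨χ', hχ', rfl⟩)⟩
  by_cases htop : sInf S = ∞
  · obtain ⟨χ, hχ⟩ := hne
    exact ⟨χ, hχ, htop ▸ le_top⟩
  obtain ⟨u, hu, hulim, huS⟩ := exists_seq_tendsto_sInf hS (OrderBot.bddBelow S)
  choose χ hχ hχu using huS
  have hlim : Tendsto (fun n => Emol μ J α ε (χ n)) atTop (𝓝 (sInf S)) := by
    simpa only [hχu] using hulim
  obtain ⟨n₀, hn₀⟩ := eventually_atTop.1 (hlim.eventually
    (gt_mem_nhds (ENNReal.lt_add_right htop one_ne_zero)))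
  exact exists_plan_of_tendsto_Emol hμ hJ hε hα.2 (fun n => hχ (n + n₀))
    ((tendsto_add_atTop_iff_nat n₀).2 hlim) (ENNReal.add_ne_top.2 ⟨htop, ENNReal.one_ne_top⟩)
    fun n => (hn₀ _ (Nat.le_add_left _ _)).le

end
end

section
/- Let χ ∈ IP(μ) be an admissible irrigation plan and α ∈ [0,1]. Then the mollified irrigation costs converge to the irrigation cost as the mollification parameter tends to zero: lim_{ε→0+} E^α_ε(χ) = E^α(χ). -/
open MeasureTheory Filter Topology
open scoped ENNReal NNReal

noncomputable section

/-- A version of the distance to a path which only uses rational times. -/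
def ratInfDist {d : ℕ} (χ : ℝ → ℝ → Euc d) (θ : ℝ) (x : Euc d) : ℝ :=
  ⨅ t : Set.range ((↑) : ℚ → ℝ), dist (χ θ (max t 0)) x

/-- The mollified multiplicity, with the path distance computed along rational times. -/
def ratWmol {d : ℕ} (μ : Measure (Euc d)) (J : ℝ → ℝ) (ε : ℝ) (χ : ℝ → ℝ → Euc d)
    (x : Euc d) : ℝ≥0∞ :=
  ∫⁻ θ in Theta μ, ENNReal.ofReal (J (max 0 (ratInfDist χ θ x / ε)))

/-- The limit superior of the speeds of the difference quotients of a path. -/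
def upperSpeed {d : ℕ} (γ : ℝ → Euc d) (t : ℝ) : ℝ≥0∞ :=
  limsup (fun n : ℕ => ‖(1 / ((n : ℝ) + 1))⁻¹ • (γ (t + 1 / ((n : ℝ) + 1)) - γ t)‖ₑ) atTop

section

variable {d : ℕ} {χ : ℝ → ℝ → Euc d}

lemma pathInfDist_nonneg (χ : ℝ → ℝ → Euc d) (θ : ℝ) (x : Euc d) : 0 ≤ pathInfDist χ θ x :=
  Real.iInf_nonneg fun _ => dist_nonneg

lemma bddBelow_range_dist {ι : Sort*} (f : ι → Euc d) (x : Euc d) :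
    BddBelow (Set.range fun i => dist (f i) x) :=
  ⟨0, by rintro _ ⟨i, rfl⟩; exact dist_nonneg⟩

lemma pathInfDist_eq_ratInfDist {θ : ℝ} (h : Continuous (χ θ)) (x : Euc d) :
    pathInfDist χ θ x = ratInfDist χ θ x := by
  have hsurj : Function.Surjective (fun t : ℝ => (⟨max t 0, le_max_right t 0⟩ : Set.Ici (0:ℝ))) :=
    fun s => ⟨s, Subtype.ext (max_eq_left s.2)⟩
  have hdense : Dense (Set.range ((↑) : ℚ → ℝ)) := Rat.denseRange_cast
  rw [ratInfDist, hdense.ciInf' (f := fun t : ℝ => dist (χ θ (max t 0)) x) (by fun_prop)]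
  exact (hsurj.iInf_comp (fun s : Set.Ici (0:ℝ) => dist (χ θ s) x)).symm

lemma measurable_ratInfDist (h : Measurable (Function.uncurry χ)) :
    Measurable (Function.uncurry (ratInfDist χ)) := by
  have : Countable (Set.range ((↑) : ℚ → ℝ)) := (Set.countable_range _).to_subtype
  refine Measurable.iInf fun t => Measurable.dist ?_ measurable_snd
  exact h.comp (measurable_fst.prodMk measurable_const)

lemma measurable_comp_max {J : ℝ → ℝ} (hJ : AntitoneOn J (Set.Ici 0)) :
    Measurable fun r => J (max 0 r) :=
  Antitone.measurable fun _ _ hab => hJ (Set.mem_Ici.2 (le_max_left _ _))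
    (Set.mem_Ici.2 (le_max_left _ _)) (max_le_max le_rfl hab)

lemma measurable_ratWmol (h : Measurable (Function.uncurry χ)) (μ : Measure (Euc d))
    {J : ℝ → ℝ} (hJ : AntitoneOn J (Set.Ici 0)) (ε : ℝ) : Measurable (ratWmol μ J ε χ) := by
  refine Measurable.lintegral_prod_left (f := fun θ x =>
    ENNReal.ofReal (J (max 0 (ratInfDist χ θ x / ε)))) ?_
  exact ((measurable_comp_max hJ).comp ((measurable_ratInfDist h).div_const ε)).ennreal_ofReal

lemma Wmol_eq_ratWmol {μ : Measure (Euc d)} (h : ∀ θ ∈ Theta μ, Continuous (χ θ))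
    (J : ℝ → ℝ) {ε : ℝ} (hε : 0 < ε) (x : Euc d) : Wmol μ J ε χ x = ratWmol μ J ε χ x := by
  refine setLIntegral_congr_fun measurableSet_Icc fun θ hθ => ?_
  rw [← pathInfDist_eq_ratInfDist (h θ hθ),
    max_eq_right (div_nonneg (pathInfDist_nonneg χ θ x) hε.le)]

lemma pathInfDist_eq_zero_iff {θ : ℝ} (hc : Continuous (χ θ))
    (he : ∃ t, 0 < t ∧ ∀ t' ≥ t, χ θ t' = χ θ t) (x : Euc d) :
    pathInfDist χ θ x = 0 ↔ ∃ t, 0 ≤ t ∧ χ θ t = x := by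
  constructor
  · intro h0
    obtain ⟨T, hT, hconst⟩ := he
    obtain ⟨s, hs, hmin⟩ := isCompact_Icc.exists_isMinOn (Set.nonempty_Icc.2 hT.le)
      (f := fun t => dist (χ θ t) x) (by fun_prop)
    refine ⟨s, hs.1, dist_le_zero.1 ?_⟩
    rw [← h0]
    refine le_ciInf fun t => ?_
    rcases le_total (t : ℝ) T with ht | ht
    · exact hmin ⟨t.2, ht⟩
    · rw [hconst t ht]
      exact hmin ⟨hT.le, le_rfl⟩
  · rintro ⟨t, ht, rfl⟩
    refine le_antisymm ?_ (pathInfDist_nonneg χ θ _)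
    exact (ciInf_le (bddBelow_range_dist _ _) (⟨t, ht⟩ : Set.Ici (0:ℝ))).trans (dist_self _).le

lemma mult_eq_lintegral {μ : Measure (Euc d)} (hχ : IsIrrigPlan μ χ) (x : Euc d) :
    mult μ χ x = ∫⁻ θ in Theta μ, {θ | ratInfDist χ θ x = 0}.indicator 1 θ := by
  have hm : MeasurableSet {θ | ratInfDist χ θ x = 0} :=
    (measurable_ratInfDist hχ.measurable).of_uncurry_right (measurableSet_singleton 0)
  rw [lintegral_indicator_one hm, Measure.restrict_apply hm, mult]
  congr 1
  ext θ
  refine and_comm.trans (and_congr_left_iff.2 ?_)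
  intro hθ
  have hc := (hχ.lipschitz θ hθ).continuous
  simpa [pathInfDist_eq_ratInfDist hc] using
    (pathInfDist_eq_zero_iff hc (hχ.eventuallyConst θ hθ) x).symm

lemma MollKernel.le_one {J : ℝ → ℝ} (hJ : MollKernel J) {r : ℝ} (hr : 0 ≤ r) : J r ≤ 1 :=
  hJ.2.2.2.1 ▸ hJ.2.1 (Set.self_mem_Ici) hr hr

lemma mult_le_ratWmol {μ : Measure (Euc d)} {J : ℝ → ℝ} (hJ : MollKernel J)
    (hχ : IsIrrigPlan μ χ) (ε : ℝ) (x : Euc d) : mult μ χ x ≤ ratWmol μ J ε χ x := by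
  rw [mult_eq_lintegral hχ]
  refine lintegral_mono fun θ => ?_
  by_cases h : ratInfDist χ θ x = 0 <;> simp [Set.indicator, h, hJ.2.2.2.1]

lemma tendsto_ratWmol {μ : Measure (Euc d)} {J : ℝ → ℝ} (hJ : MollKernel J)
    (hχ : IsIrrigPlan μ χ) (x : Euc d) :
    Tendsto (fun ε => ratWmol μ J ε χ x) (𝓝[>] 0) (𝓝 (mult μ χ x)) := by
  have hρ : Measurable fun θ => ratInfDist χ θ x :=
    (measurable_ratInfDist hχ.measurable).of_uncurry_right
  rw [mult_eq_lintegral hχ]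
  have hm : ∀ ε, Measurable fun θ => ENNReal.ofReal (J (max 0 (ratInfDist χ θ x / ε))) :=
    fun ε => ((measurable_comp_max hJ.2.1).comp (hρ.div_const ε)).ennreal_ofReal
  refine tendsto_lintegral_filter_of_dominated_convergence (fun _ => 1) (.of_forall hm)
    (.of_forall fun ε => .of_forall fun θ => ENNReal.ofReal_le_one.2 (hJ.le_one (le_max_left _ _)))
    (by simp [Theta]) (.of_forall fun θ => ?_)
  have hnonneg : 0 ≤ ratInfDist χ θ x := Real.iInf_nonneg fun _ => dist_nonneg
  rcases hnonneg.eq_or_lt' with h0 | hpos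
  · simp [Set.indicator, h0, hJ.2.2.2.1]
  · have hdiv : Tendsto (fun ε => max 0 (ratInfDist χ θ x / ε)) (𝓝[>] (0:ℝ)) atTop :=
      tendsto_atTop_mono (fun ε => le_max_right _ _)
        ((tendsto_inv_nhdsGT_zero.const_mul_atTop hpos).congr fun ε => (div_eq_mul_inv _ ε).symm)
    have := ENNReal.tendsto_ofReal (hJ.2.2.2.2.comp hdiv)
    simpa [Set.indicator, hpos.ne'] using this

lemma measurable_upperSpeed (h : Measurable (Function.uncurry χ)) :
    Measurable fun p : ℝ × ℝ => upperSpeed (χ p.1) p.2 := by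
  have hshift : ∀ s : ℝ, Measurable fun p : ℝ × ℝ => χ p.1 (p.2 + s) := fun s =>
    h.comp (measurable_fst.prodMk (measurable_snd.add_const s))
  have hquot : ∀ s : ℝ, Measurable fun p : ℝ × ℝ => ‖s⁻¹ • (χ p.1 (p.2 + s) - χ p.1 p.2)‖ₑ :=
    fun s => (((hshift s).sub h).const_smul s⁻¹).enorm
  exact Measurable.limsup fun n : ℕ => hquot (1 / ((n : ℝ) + 1))

lemma upperSpeed_eq_of_differentiableAt {γ : ℝ → Euc d} {t : ℝ} (h : DifferentiableAt ℝ γ t) :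
    upperSpeed γ t = (‖deriv γ t‖₊ : ℝ≥0∞) := by
  have hn : Tendsto (fun n : ℕ => 1 / ((n : ℝ) + 1)) atTop (𝓝[≠] 0) :=
    tendsto_nhdsWithin_iff.2 ⟨tendsto_one_div_add_atTop_nhds_zero_nat,
      .of_forall fun n => (Nat.one_div_pos_of_nat).ne'⟩
  have hlim : Tendsto (fun n : ℕ =>
      ‖(1 / ((n : ℝ) + 1))⁻¹ • (γ (t + 1 / ((n : ℝ) + 1)) - γ t)‖ₑ) atTop (𝓝 ‖deriv γ t‖ₑ) :=
    (h.hasDerivAt.tendsto_slope_zero.comp hn).enorm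
  exact hlim.limsup_eq

lemma ENNReal.rpow_le_rpow_of_exponent_nonpos {a b : ℝ≥0∞} (hab : a ≤ b) {z : ℝ} (hz : z ≤ 0) :
    b ^ z ≤ a ^ z := by
  rw [← neg_neg z, ENNReal.rpow_neg, ENNReal.rpow_neg a, ENNReal.inv_le_inv]
  exact ENNReal.rpow_le_rpow hab (neg_nonneg.2 hz)

end

/-- the mollified irrigation costs converge to the irrigation cost as `ε → 0+`. -/
theorem mollified_cost_tendsto_cost {d : ℕ} (hd : 1 ≤ d)
    (μ : Measure (Euc d)) [IsFiniteMeasure μ]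
    (hsupp : ∃ R : ℝ, μ (Metric.closedBall 0 R)ᶜ = 0)
    (J : ℝ → ℝ) (hJ : MollKernel J)
    (α : ℝ) (hα : α ∈ Set.Icc (0:ℝ) 1)
    (χ : ℝ → ℝ → Euc d) (hχ : IsIrrigPlan μ χ) :
    Tendsto (fun ε : ℝ => Emol μ J α ε χ) (𝓝[>] (0:ℝ)) (𝓝 (irrCost μ α χ)) := by
  have hcont : ∀ θ ∈ Theta μ, Continuous (χ θ) := fun θ hθ => (hχ.lipschitz θ hθ).continuous
  set G : ℝ → ℝ → ℝ → ℝ≥0∞ := fun ε θ t =>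
    ratWmol μ J ε χ (χ θ t) ^ (α - 1) * upperSpeed (χ θ) t with hG
  have hGm : ∀ ε, Measurable (Function.uncurry (G ε)) := fun ε =>
    (((measurable_ratWmol hχ.measurable μ hJ.2.1 ε).comp hχ.measurable).pow_const _).mul
      (measurable_upperSpeed hχ.measurable)
  have hspeed : ∀ θ ∈ Theta μ, ∀ᵐ t ∂volume.restrict (Set.Ici (0:ℝ)),
      upperSpeed (χ θ) t = (‖deriv (χ θ) t‖₊ : ℝ≥0∞) := fun θ hθ =>
    ae_restrict_of_ae <| (hχ.lipschitz θ hθ).ae_differentiableAt_real.mono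
      fun t ht => upperSpeed_eq_of_differentiableAt ht
  have hEmol : (fun ε => Emol μ J α ε χ) =ᶠ[𝓝[>] 0]
      fun ε => ∫⁻ θ in Theta μ, ∫⁻ t in Set.Ici (0:ℝ), G ε θ t := by
    filter_upwards [self_mem_nhdsWithin] with ε hε
    refine setLIntegral_congr_fun measurableSet_Icc fun θ hθ => lintegral_congr_ae ?_
    filter_upwards [hspeed θ hθ] with t ht
    simp only [hG, ht, Wmol_eq_ratWmol hcont J hε]
  refine Tendsto.congr' hEmol.symm (tendsto_of_le_liminf_of_limsup_le ?_ ?_)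
  · calc irrCost μ α χ
        = ∫⁻ θ in Theta μ, ∫⁻ t in Set.Ici (0:ℝ), liminf (fun ε => G ε θ t) (𝓝[>] 0) := by
          refine setLIntegral_congr_fun measurableSet_Icc fun θ hθ => lintegral_congr_ae ?_
          filter_upwards [hspeed θ hθ] with t ht
          simp only [hG, ht]
          have hpow : Tendsto (fun ε => ratWmol μ J ε χ (χ θ t) ^ (α - 1)) (𝓝[>] 0)
              (𝓝 (mult μ χ (χ θ t) ^ (α - 1))) :=
            (tendsto_ratWmol hJ hχ (χ θ t)).ennrpow_const _
          exact (ENNReal.Tendsto.mul_const hpow (Or.inr ENNReal.coe_ne_top)).liminf_eq.symm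
      _ ≤ ∫⁻ θ in Theta μ, liminf (fun ε => ∫⁻ t in Set.Ici (0:ℝ), G ε θ t) (𝓝[>] 0) :=
          lintegral_mono fun θ => lintegral_liminf_le fun ε => (hGm ε).of_uncurry_left
      _ ≤ liminf (fun ε => ∫⁻ θ in Theta μ, ∫⁻ t in Set.Ici (0:ℝ), G ε θ t) (𝓝[>] 0) :=
          lintegral_liminf_le fun ε => (hGm ε).lintegral_prod_right
  · refine limsup_le_of_le (h := .of_forall fun ε => ?_)
    refine setLIntegral_mono' measurableSet_Icc fun θ hθ => lintegral_mono_ae ?_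
    filter_upwards [hspeed θ hθ] with t ht
    simp only [hG, ht]
    exact mul_le_mul_left (ENNReal.rpow_le_rpow_of_exponent_nonpos
      (mult_le_ratWmol hJ hχ ε _) (sub_nonpos.2 hα.2)) _

end
end
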